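/- arXiv:1603.05085 — 4 statements merged into one kernel-verified Lean document; each statement's English description precedes it below -/
import Mathlib

section
/- Let d ≥ 1, k ≥ 0, and let E : ℝ^d → ℝ^d satisfy (H0). Then for every φ ∈ C_c^∞(ℝ^d; ℝ), ∫_{ℝ^d} (∇φ(x) + E(x) φ(x)) · ∇(φ(x) ⟨x⟩^k) dx = ∫_{ℝ^d} |∇φ(x)|² ⟨x⟩^k dx + (1/2) ∫_{ℝ^d} φ(x)² Ψ_k(x) dx, where Ψ_k(x) := −Δ(⟨x⟩^k) − div E(x) ⟨x⟩^k + E(x) · ∇(⟨x⟩^k). -/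
open MeasureTheory Real Filter Topology RealInnerProductSpace
open scoped BigOperators

noncomputable section

/-- The weight `⟨x⟩ᵏ = (1+|x|²)^{k/2}`. -/
def jap {d : ℕ} (k : ℝ) (x : EuclideanSpace ℝ (Fin d)) : ℝ :=
  (1 + ‖x‖ ^ 2) ^ (k / 2)

/-- The divergence of a vector field on `ℝᵈ`. -/
def dvg {d : ℕ} (E : EuclideanSpace ℝ (Fin d) → EuclideanSpace ℝ (Fin d))
    (x : EuclideanSpace ℝ (Fin d)) : ℝ :=
  ∑ i, ⟪fderiv ℝ E x (EuclideanSpace.single i 1), EuclideanSpace.single i 1⟫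

/-- The Laplacian of a scalar function on `ℝᵈ`. -/
def lap {d : ℕ} (f : EuclideanSpace ℝ (Fin d) → ℝ) (x : EuclideanSpace ℝ (Fin d)) : ℝ :=
  dvg (gradient f) x

/-- The Fokker–Planck operator `Lf = div(∇f + E f)`. -/
def Lop {d : ℕ} (E : EuclideanSpace ℝ (Fin d) → EuclideanSpace ℝ (Fin d))
    (f : EuclideanSpace ℝ (Fin d) → ℝ) (x : EuclideanSpace ℝ (Fin d)) : ℝ :=
  dvg (fun y => gradient f y + f y • E y) x

/-- Hypothesis (H0): `E ∈ W^{1,∞}_loc(ℝᵈ; ℝᵈ)` (classical formulation: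
`E` is differentiable with locally bounded values and derivative). -/
def H0 {d : ℕ} (E : EuclideanSpace ℝ (Fin d) → EuclideanSpace ℝ (Fin d)) : Prop :=
  Differentiable ℝ E ∧ ∀ R : ℝ, ∃ C : ℝ, ∀ x, ‖x‖ ≤ R → ‖E x‖ + ‖fderiv ℝ E x‖ ≤ C

/-- Hypothesis (H1): `α|x|^γ − β ≤ x·E(x) ≤ α₂|x|^{γ₂} + β₂` with
`α, α₂ > 0` and `1 < γ ≤ γ₂ ≤ 2`. -/
def H1 {d : ℕ} (E : EuclideanSpace ℝ (Fin d) → EuclideanSpace ℝ (Fin d)) : Prop :=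
  ∃ α α₂ β β₂ γ γ₂ : ℝ, 0 < α ∧ 0 < α₂ ∧ 1 < γ ∧ γ ≤ γ₂ ∧ γ₂ ≤ 2 ∧
    ∀ x : EuclideanSpace ℝ (Fin d),
      α * ‖x‖ ^ γ - β ≤ ⟪x, E x⟫ ∧ ⟪x, E x⟫ ≤ α₂ * ‖x‖ ^ γ₂ + β₂

/-- Hypothesis (H2) with `p = 2` (so `p/p' = 1`) and constant `β₀`:
`−div E(x) + k x·E(x)/(1+|x|²) ≥ β₀` for all `x`. -/
def H2 {d : ℕ} (k β₀ : ℝ) (E : EuclideanSpace ℝ (Fin d) → EuclideanSpace ℝ (Fin d)) : Prop :=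
  ∀ x : EuclideanSpace ℝ (Fin d), β₀ ≤ -dvg E x + k * ⟪x, E x⟫ / (1 + ‖x‖ ^ 2)

/-- Hypothesis (H3) with `p = 2` and constant `ω* > 0`:
`−(kd + k(k+d−2)|x|²)/(1+|x|²)² − div E(x) + k x·E(x)/(1+|x|²) ≥ ω*` for all `x`. -/
def H3 {d : ℕ} (k ωs : ℝ) (E : EuclideanSpace ℝ (Fin d) → EuclideanSpace ℝ (Fin d)) : Prop :=
  ∀ x : EuclideanSpace ℝ (Fin d),
    ωs ≤ -(k * (d : ℝ) + k * (k + (d : ℝ) - 2) * ‖x‖ ^ 2) / (1 + ‖x‖ ^ 2) ^ 2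
          - dvg E x + k * ⟪x, E x⟫ / (1 + ‖x‖ ^ 2)

/-- The diagonal partial derivatives of a field satisfying `H0` are locally integrable. -/
theorem H0.locallyIntegrable_partial {d : ℕ}
    {E : EuclideanSpace ℝ (Fin d) → EuclideanSpace ℝ (Fin d)} (hE : H0 E) (i : Fin d) :
    LocallyIntegrable (fun x => ⟪fderiv ℝ E x (EuclideanSpace.single i 1),
      (EuclideanSpace.single i 1 : EuclideanSpace ℝ (Fin d))⟫) := by
  rw [locallyIntegrable_iff]
  intro K hK
  obtain ⟨R, hR⟩ := hK.isBounded.exists_norm_le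
  obtain ⟨C, hC⟩ := hE.2 R
  refine Measure.integrableOn_of_bounded (M := C) hK.measure_lt_top.ne ?_ ?_
  · exact ((measurable_fderiv_apply_const ℝ E _).inner measurable_const).aestronglyMeasurable
  · refine ae_restrict_of_forall_mem hK.measurableSet fun x hx => ?_
    have hn : ‖(EuclideanSpace.single i 1 : EuclideanSpace ℝ (Fin d))‖ = 1 := by simp
    calc _ ≤ ‖fderiv ℝ E x (EuclideanSpace.single i 1)‖ *
            ‖(EuclideanSpace.single i 1 : EuclideanSpace ℝ (Fin d))‖ := norm_inner_le_norm _ _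
      _ ≤ ‖fderiv ℝ E x‖ := by
          rw [hn, mul_one]
          simpa [hn] using (fderiv ℝ E x).le_opNorm (EuclideanSpace.single i 1)
      _ ≤ C := by linarith [hC x (hR x hx), norm_nonneg (E x)]

theorem H0.integrable_mul_dvg {d : ℕ}
    {E : EuclideanSpace ℝ (Fin d) → EuclideanSpace ℝ (Fin d)} (hE : H0 E)
    {g : EuclideanSpace ℝ (Fin d) → ℝ} (hg : Continuous g) (hgc : HasCompactSupport g) :
    Integrable (fun x => g x * dvg E x) := by
  simp only [dvg, Finset.mul_sum]
  exact integrable_finsetSum _ fun i _ =>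
    (hE.locallyIntegrable_partial i).integrable_smul_left_of_hasCompactSupport hg hgc

theorem continuous_gradient {F : Type*} [NormedAddCommGroup F] [InnerProductSpace ℝ F]
    [CompleteSpace F] {g : F → ℝ} (hg : ContDiff ℝ 1 g) : Continuous (gradient g) :=
  (InnerProductSpace.toDual ℝ F).symm.continuous.comp (hg.continuous_fderiv one_ne_zero)

/-- Integration by parts of the divergence against a compactly supported `C¹` function. -/
theorem H0.integral_mul_dvg {d : ℕ}
    {E : EuclideanSpace ℝ (Fin d) → EuclideanSpace ℝ (Fin d)} (hE : H0 E)
    {g : EuclideanSpace ℝ (Fin d) → ℝ} (hg : ContDiff ℝ 1 g) (hgc : HasCompactSupport g) :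
    ∫ x, g x * dvg E x = -∫ x, ⟪gradient g x, E x⟫ := by
  have hEc : Continuous E := hE.1.continuous
  have hpart (i : Fin d) (x) : fderiv ℝ (fun y => ⟪E y,
      (EuclideanSpace.single i 1 : EuclideanSpace ℝ (Fin d))⟫) x (EuclideanSpace.single i 1) =
      ⟪fderiv ℝ E x (EuclideanSpace.single i 1),
        (EuclideanSpace.single i 1 : EuclideanSpace ℝ (Fin d))⟫ := by
    rw [fderiv_inner_apply ℝ (hE.1 x) (differentiableAt_const _)]
    simp
  have int_left (i : Fin d) : Integrable (fun x => g x * ⟪fderiv ℝ E x (EuclideanSpace.single i 1),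
      (EuclideanSpace.single i 1 : EuclideanSpace ℝ (Fin d))⟫) :=
    (hE.locallyIntegrable_partial i).integrable_smul_left_of_hasCompactSupport hg.continuous hgc
  have int_right (i : Fin d) : Integrable (fun x => fderiv ℝ g x (EuclideanSpace.single i 1) *
      ⟪E x, (EuclideanSpace.single i 1 : EuclideanSpace ℝ (Fin d))⟫) := by
    refine Continuous.integrable_of_hasCompactSupport ?_ (hgc.fderiv_apply ℝ _).mul_right
    exact ((hg.continuous_fderiv one_ne_zero).clm_apply continuous_const).mul
      (hEc.inner continuous_const)
  have hinner (x) : ⟪gradient g x, E x⟫ = ∑ i, fderiv ℝ g x (EuclideanSpace.single i 1) *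
      ⟪E x, (EuclideanSpace.single i 1 : EuclideanSpace ℝ (Fin d))⟫ := by
    rw [← (EuclideanSpace.basisFun (Fin d) ℝ).sum_inner_mul_inner]
    refine Finset.sum_congr rfl fun i _ => ?_
    rw [EuclideanSpace.basisFun_apply, inner_gradient_left, real_inner_comm]
  simp only [hinner, dvg, Finset.mul_sum]
  rw [integral_finsetSum _ fun i _ => int_left i, integral_finsetSum _ fun i _ => int_right i,
    ← Finset.sum_neg_distrib]
  refine Finset.sum_congr rfl fun i _ => ?_
  simp only [← hpart]
  refine integral_mul_fderiv_eq_neg_fderiv_mul_of_integrable (int_right i)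
    (by simpa only [hpart] using int_left i) ?_
    (fun x _ => hg.differentiable one_ne_zero x)
    (fun x _ => (hE.1 x).inner ℝ (differentiableAt_const _))
  exact (hg.continuous.mul (hEc.inner continuous_const)).integrable_of_hasCompactSupport
    hgc.mul_right

theorem contDiff_jap {d : ℕ} (k : ℝ) :
    ContDiff ℝ 2 (jap k : EuclideanSpace ℝ (Fin d) → ℝ) :=
  (contDiff_const.add (contDiff_norm_sq ℝ)).rpow_const_of_ne fun x => by positivity

theorem gradient_mul {F : Type*} [NormedAddCommGroup F] [InnerProductSpace ℝ F]
    [CompleteSpace F] {f g : F → ℝ} {x : F} (hf : DifferentiableAt ℝ f x)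
    (hg : DifferentiableAt ℝ g x) :
    gradient (fun y => f y * g y) x = f x • gradient g x + g x • gradient f x := by
  simp only [gradient, fderiv_fun_mul hf hg, map_add, map_smulₛₗ, RCLike.conj_to_real]

/-- A `C¹` field is differentiable with locally bounded values and derivative. -/
theorem H0.of_contDiff {d : ℕ} {E : EuclideanSpace ℝ (Fin d) → EuclideanSpace ℝ (Fin d)}
    (hE : ContDiff ℝ 1 E) : H0 E := by
  refine ⟨hE.differentiable one_ne_zero, fun R => ?_⟩
  obtain ⟨C, hC⟩ := (isCompact_closedBall (0 : EuclideanSpace ℝ (Fin d)) R).bddAbove_image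
    (f := fun x => ‖E x‖ + ‖fderiv ℝ E x‖)
    (hE.continuous.norm.add (hE.continuous_fderiv one_ne_zero).norm).continuousOn
  exact ⟨C, fun x hx => hC ⟨x, by simpa using hx, rfl⟩⟩

theorem contDiff_gradient {F : Type*} [NormedAddCommGroup F] [InnerProductSpace ℝ F]
    [CompleteSpace F] {g : F → ℝ} (hg : ContDiff ℝ 2 g) : ContDiff ℝ 1 (gradient g) :=
  (InnerProductSpace.toDual ℝ F).symm.toContinuousLinearEquiv.contDiff.comp
    (hg.fderiv_right (m := 1) (by norm_num))

/-- the weak-form identity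
`∫ (∇φ + Eφ)·∇(φ⟨x⟩ᵏ) = ∫ |∇φ|²⟨x⟩ᵏ + (1/2) ∫ φ² Ψₖ`, where
`Ψₖ = −Δ(⟨x⟩ᵏ) − (div E)⟨x⟩ᵏ + E·∇(⟨x⟩ᵏ)`. -/
theorem stmt2 (d : ℕ) (hd : 1 ≤ d) (k : ℝ) (hk : 0 ≤ k)
    (E : EuclideanSpace ℝ (Fin d) → EuclideanSpace ℝ (Fin d)) (hE0 : H0 E)
    (φ : EuclideanSpace ℝ (Fin d) → ℝ)
    (hφ : ContDiff ℝ (⊤ : ℕ∞) φ) (hφc : HasCompactSupport φ) :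
    (∫ x, ⟪gradient φ x + φ x • E x, gradient (fun y => φ y * jap k y) x⟫)
      = (∫ x, ‖gradient φ x‖ ^ 2 * jap k x)
        + (1 / 2) * ∫ x, φ x ^ 2 *
            (-lap (jap k) x - dvg E x * jap k x + ⟪E x, gradient (jap k) x⟫) := by
  have hw := contDiff_jap (d := d) k
  have hφ1 : ContDiff ℝ 1 φ := hφ.of_le (by exact_mod_cast le_top)
  have hw1 : ContDiff ℝ 1 (jap k : EuclideanSpace ℝ (Fin d) → ℝ) := hw.of_le (by norm_num)
  have hdφ := hφ1.differentiable one_ne_zero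
  have hdw := hw1.differentiable one_ne_zero
  have hcφ := hφ1.continuous
  have hcw := hw1.continuous
  have hcE : Continuous E := hE0.1.continuous
  have hcgφ := continuous_gradient hφ1
  have hcgw := continuous_gradient hw1
  have hsq : ContDiff ℝ 1 fun x => φ x * φ x := hφ1.mul hφ1
  have hsqw : ContDiff ℝ 1 fun x => φ x * φ x * jap k x := hsq.mul hw1
  have hsqc : HasCompactSupport fun x => φ x * φ x := hφc.mul_right
  have hsqwc : HasCompactSupport fun x => φ x * φ x * jap k x := hsqc.mul_right
  have hgw : H0 (gradient (jap k : EuclideanSpace ℝ (Fin d) → ℝ)) :=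
    .of_contDiff (contDiff_gradient hw)
  have parts_w := hgw.integral_mul_dvg hsq hsqc
  have parts_E := hE0.integral_mul_dvg hsqw hsqwc
  have int_w := hgw.integrable_mul_dvg hsq.continuous hsqc
  have int_E := hE0.integrable_mul_dvg hsqw.continuous hsqwc
  have hgsq (x) : gradient (fun y => φ y * φ y) x = (2 * φ x) • gradient φ x := by
    rw [gradient_mul (hdφ x) (hdφ x), ← add_smul, two_mul]
  have hgsqw (x) : gradient (fun y => φ y * φ y * jap k y) x =
      (φ x * φ x) • gradient (jap k) x + jap k x • (2 * φ x) • gradient φ x := by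
    rw [gradient_mul (hsq.differentiable one_ne_zero x) (hdw x), hgsq]
  have int_grad : Integrable fun x => ‖gradient φ x‖ ^ 2 * jap k x := by
    refine ((hcgφ.norm.pow 2).mul hcw).integrable_of_hasCompactSupport
      (hφc.mono' fun x hx => ?_)
    contrapose! hx
    have : gradient φ x = 0 := by
      simp [gradient, fderiv_of_notMem_tsupport ℝ hx]
    simp [this]
  have int_Ew : Integrable fun x => φ x * φ x * ⟪E x, gradient (jap k) x⟫ :=
    (hsq.continuous.mul (hcE.inner hcgw)).integrable_of_hasCompactSupport hsqc.mul_right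
  have int_φw : Integrable fun x => ⟪gradient (fun y => φ y * φ y) x, gradient (jap k) x⟫ := by
    simp only [hgsq, real_inner_smul_left]
    exact ((continuous_const.mul hcφ).mul (hcgφ.inner hcgw)).integrable_of_hasCompactSupport
      (hφc.mul_left.mul_right)
  have int_φE : Integrable fun x => ⟪gradient (fun y => φ y * φ y * jap k y) x, E x⟫ := by
    refine ((continuous_gradient hsqw).inner hcE).integrable_of_hasCompactSupport
      (hφc.mono fun x hx => ?_)
    contrapose! hx
    simp only [Function.mem_support, not_not] at hx ⊢
    simp [hgsqw, hx]
  have lhs_eq (x) : ⟪gradient φ x + φ x • E x, gradient (fun y => φ y * jap k y) x⟫ =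
      ‖gradient φ x‖ ^ 2 * jap k x +
        (1 / 2) * (⟪gradient (fun y => φ y * φ y) x, gradient (jap k) x⟫ +
          ⟪gradient (fun y => φ y * φ y * jap k y) x, E x⟫ +
          φ x * φ x * ⟪E x, gradient (jap k) x⟫) := by
    rw [hgsq, hgsqw, gradient_mul (hdφ x) (hdw x)]
    simp only [inner_add_left, inner_add_right, real_inner_smul_left, real_inner_smul_right,
      real_inner_self_eq_norm_sq, real_inner_comm (E x)]
    ring
  have rhs_eq (x) : φ x ^ 2 *
      (-lap (jap k) x - dvg E x * jap k x + ⟪E x, gradient (jap k) x⟫) =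
      -(φ x * φ x * dvg (gradient (jap k)) x) - φ x * φ x * jap k x * dvg E x +
        φ x * φ x * ⟪E x, gradient (jap k) x⟫ := by
    rw [lap]; ring
  simp only [lhs_eq, rhs_eq]
  rw [integral_add int_grad (((int_φw.fun_add int_φE).fun_add int_Ew).const_mul _),
    integral_const_mul, integral_add (int_φw.fun_add int_φE) int_Ew, integral_add int_φw int_φE,
    integral_add (by exact int_w.neg.sub int_E) int_Ew, integral_sub int_w.fun_neg int_E,
    integral_neg, parts_w, parts_E]
  ring
end
end

section
/- Let d ≥ 1 and k be such that k > 0 if d ≥ 2, and k ≥ 2 if d = 1. Then there exists a constant C > 0 (depending only on d) such that for every f ∈ L¹_{k/2}(ℝ^d) ∩ H¹_k(ℝ^d), the weighted Nash inequality holds: ‖f‖_{L²_k}^{2 + 4/d} ≤ C ‖f‖_{L¹_{k/2}}^{4/d} · ‖∇f‖_{L²_k}², i.e. (∫ |f|² ⟨x⟩^k dx)^{(d+2)/d} ≤ C (∫ |f| ⟨x⟩^{k/2} dx)^{4/d} (∫ |∇f|² ⟨x⟩^k dx). -/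
open MeasureTheory Real Filter Topology RealInnerProductSpace
open scoped BigOperators

noncomputable section

theorem ofReal_sq_sub_le_lintegral_sq_deriv {φ φ' : ℝ → ℝ} (hφ : ∀ t, HasDerivAt φ (φ' t) t) :
    ENNReal.ofReal ((φ 1 - φ 0) ^ 2) ≤ ∫⁻ t in Set.Ioc (0 : ℝ) 1, ENNReal.ofReal (φ' t ^ 2) := by
  have hmeas : Measurable φ' := by
    have : φ' = deriv φ := funext fun t => (hφ t).deriv.symm
    rw [this]
    exact measurable_deriv φ
  by_cases hfin : ∫⁻ t in Set.Ioc (0 : ℝ) 1, ENNReal.ofReal (φ' t ^ 2) = ⊤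
  · rw [hfin]
    exact le_top
  have : IsProbabilityMeasure (volume.restrict (Set.Ioc (0 : ℝ) 1)) :=
    ⟨by simp⟩
  have hsq : Integrable (fun t => φ' t ^ 2) (volume.restrict (Set.Ioc (0 : ℝ) 1)) :=
    (lintegral_ofReal_ne_top_iff_integrable (hmeas.pow_const 2).aestronglyMeasurable
      (ae_of_all _ fun t => sq_nonneg _)).1 hfin
  have hint : Integrable φ' (volume.restrict (Set.Ioc (0 : ℝ) 1)) :=
    ((memLp_two_iff_integrable_sq hmeas.aestronglyMeasurable).2 hsq).integrable one_le_two
  have hftc : ∫ t in Set.Ioc (0 : ℝ) 1, φ' t = φ 1 - φ 0 := by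
    rw [← intervalIntegral.integral_of_le zero_le_one]
    exact intervalIntegral.integral_eq_sub_of_hasDerivAt (fun t _ => hφ t)
      ((intervalIntegrable_iff_integrableOn_Ioc_of_le zero_le_one).2 hint)
  rw [← ofReal_integral_eq_lintegral_ofReal hsq (ae_of_all _ fun t => sq_nonneg _), ← hftc]
  refine ENNReal.ofReal_le_ofReal ?_
  exact (even_two.convexOn_pow (𝕜 := ℝ)).map_integral_le (continuous_pow 2).continuousOn
    isClosed_univ (ae_of_all _ fun _ => Set.mem_univ _) hint hsq

section Nash

variable {E : Type*} [NormedAddCommGroup E] [InnerProductSpace ℝ E] [FiniteDimensional ℝ E]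
  [MeasurableSpace E] [BorelSpace E] {μ : Measure E} [μ.IsAddHaarMeasure] {g : E → ℝ}

theorem measurable_gradient (g : E → ℝ) : Measurable (gradient g) :=
  (InnerProductSpace.toDual ℝ E).symm.continuous.measurable.comp (measurable_fderiv ℝ g)

theorem lintegral_sq_translate_sub_le (hg : Differentiable ℝ g) (h : E) :
    ∫⁻ x, ENNReal.ofReal ((g (x + h) - g x) ^ 2) ∂μ
      ≤ ENNReal.ofReal (‖h‖ ^ 2) * ∫⁻ x, ENNReal.ofReal (‖gradient g x‖ ^ 2) ∂μ := by
  have hder (x : E) (t : ℝ) :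
      HasDerivAt (fun t : ℝ => g (x + t • h)) ⟪gradient g (x + t • h), h⟫ t := by
    have h1 : HasDerivAt (fun t : ℝ => x + t • h) h t := by
      simpa using ((hasDerivAt_id t).smul_const h).const_add x
    have h2 := (hg (x + t • h)).hasFDerivAt.comp_hasDerivAt t h1
    rw [← toDual_gradient, InnerProductSpace.toDual_apply_apply] at h2
    exact h2
  have hm : Measurable fun p : E × ℝ => ENNReal.ofReal (‖gradient g (p.1 + p.2 • h)‖ ^ 2) := by
    have : Measurable fun p : E × ℝ => p.1 + p.2 • h := by fun_prop
    exact (((measurable_gradient g).comp this).norm.pow_const 2).ennreal_ofReal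
  calc ∫⁻ x, ENNReal.ofReal ((g (x + h) - g x) ^ 2) ∂μ
      ≤ ∫⁻ x, (∫⁻ t in Set.Ioc (0 : ℝ) 1, ENNReal.ofReal (‖h‖ ^ 2) *
          ENNReal.ofReal (‖gradient g (x + t • h)‖ ^ 2)) ∂μ := by
        refine lintegral_mono fun x => ?_
        have h1 := ofReal_sq_sub_le_lintegral_sq_deriv (hder x)
        simp only [one_smul, zero_smul, add_zero] at h1
        refine h1.trans (lintegral_mono fun t => ?_)
        rw [← ENNReal.ofReal_mul (by positivity), ← mul_pow]
        refine ENNReal.ofReal_le_ofReal (sq_le_sq.2 ?_)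
        rw [abs_of_nonneg (by positivity : 0 ≤ ‖h‖ * ‖gradient g (x + t • h)‖), mul_comm]
        exact abs_real_inner_le_norm _ _
    _ = ∫⁻ t in Set.Ioc (0 : ℝ) 1, ∫⁻ x, ENNReal.ofReal (‖h‖ ^ 2) *
          ENNReal.ofReal (‖gradient g (x + t • h)‖ ^ 2) ∂μ :=
        lintegral_lintegral_swap (hm.const_mul _).aemeasurable
    _ = ∫⁻ t in Set.Ioc (0 : ℝ) 1, ENNReal.ofReal (‖h‖ ^ 2) *
          ∫⁻ x, ENNReal.ofReal (‖gradient g x‖ ^ 2) ∂μ := by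
        refine lintegral_congr fun t => ?_
        rw [lintegral_const_mul' _ _ ENNReal.ofReal_ne_top,
          lintegral_add_right_eq_self (fun x => ENNReal.ofReal (‖gradient g x‖ ^ 2))]
    _ = _ := by simp

theorem integral_sq_sub_le_integral_translate_mul (hg : Differentiable ℝ g)
    (h2 : Integrable (fun x => g x ^ 2) μ)
    (hD : Integrable (fun x => ‖gradient g x‖ ^ 2) μ) (h : E) :
    (∫ x, g x ^ 2 ∂μ) - ‖h‖ ^ 2 / 2 * ∫ x, ‖gradient g x‖ ^ 2 ∂μ ≤
      ∫ x, |g (x + h)| * |g x| ∂μ := by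
  have h2h : Integrable (fun x => g (x + h) ^ 2) μ := h2.comp_add_right h
  have hc : Continuous g := hg.continuous
  have hprod : Integrable (fun x => |g (x + h)| * |g x|) μ := by
    refine (h2h.add h2).mono' (by fun_prop) (ae_of_all _ fun x => ?_)
    simp only [norm_mul, Real.norm_eq_abs, abs_abs, Pi.add_apply]
    rw [← sq_abs (g (x + h)), ← sq_abs (g x)]
    nlinarith [sq_nonneg (|g (x + h)| - |g x|), sq_nonneg (|g (x + h)| + |g x|)]
  have hdiff : Integrable (fun x => (g (x + h) - g x) ^ 2) μ := by
    refine ((h2h.add h2).const_mul 2).mono' (by fun_prop) (ae_of_all _ fun x => ?_)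
    simp only [norm_pow, Real.norm_eq_abs, sq_abs, Pi.add_apply]
    nlinarith [sq_nonneg (g (x + h) + g x)]
  have hle : ∫ x, (g (x + h) - g x) ^ 2 ∂μ ≤ ‖h‖ ^ 2 * ∫ x, ‖gradient g x‖ ^ 2 ∂μ := by
    have := lintegral_sq_translate_sub_le (μ := μ) hg h
    rw [← ofReal_integral_eq_lintegral_ofReal hdiff (ae_of_all _ fun t => sq_nonneg _),
      ← ofReal_integral_eq_lintegral_ofReal hD (ae_of_all _ fun t => sq_nonneg _),
      ← ENNReal.ofReal_mul (by positivity)] at this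
    exact (ENNReal.ofReal_le_ofReal_iff (by positivity)).1 this
  have heq : ∫ x, g (x + h) ^ 2 ∂μ = ∫ x, g x ^ 2 ∂μ :=
    integral_add_right_eq_self (fun x => g x ^ 2) h
  have hlow : (∫ x, g (x + h) ^ 2 ∂μ) + (∫ x, g x ^ 2 ∂μ) - 2 * ∫ x, |g (x + h)| * |g x| ∂μ ≤
      ∫ x, (g (x + h) - g x) ^ 2 ∂μ := by
    have hsum : Integrable (fun x => g (x + h) ^ 2 + g x ^ 2) μ := h2h.add h2
    rw [← integral_add h2h h2, ← integral_const_mul,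
      ← integral_sub hsum (hprod.const_mul 2)]
    refine integral_mono (hsum.sub (hprod.const_mul 2)) hdiff fun x => ?_
    have := le_abs_self (g (x + h) * g x)
    rw [abs_mul] at this
    simp only
    nlinarith
  linarith

theorem lintegral_lintegral_translate_mul (hg : Continuous g) :
    ∫⁻ h, ∫⁻ x, ENNReal.ofReal (|g (x + h)| * |g x|) ∂μ ∂μ
      = (∫⁻ x, ENNReal.ofReal |g x| ∂μ) ^ 2 := by
  rw [lintegral_lintegral_swap (by
    refine (Continuous.measurable ?_).ennreal_ofReal.aemeasurable
    fun_prop)]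
  simp_rw [ENNReal.ofReal_mul (abs_nonneg _)]
  have (x : E) : ∫⁻ h, ENNReal.ofReal |g (x + h)| * ENNReal.ofReal |g x| ∂μ
      = (∫⁻ y, ENNReal.ofReal |g y| ∂μ) * ENNReal.ofReal |g x| := by
    rw [lintegral_mul_const' _ _ ENNReal.ofReal_ne_top,
      lintegral_add_left_eq_self (fun y => ENNReal.ofReal |g y|)]
  simp_rw [this]
  rw [lintegral_const_mul _ (by fun_prop), sq]

theorem sub_mul_measure_ball_le (hg : Differentiable ℝ g)
    (h1 : Integrable g μ) (h2 : Integrable (fun x => g x ^ 2) μ)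
    (hD : Integrable (fun x => ‖gradient g x‖ ^ 2) μ) (r : ℝ) :
    ((∫ x, g x ^ 2 ∂μ) - r ^ 2 / 2 * ∫ x, ‖gradient g x‖ ^ 2 ∂μ) * μ.real (Metric.ball 0 r) ≤
      (∫ x, |g x| ∂μ) ^ 2 := by
  set a := (∫ x, g x ^ 2 ∂μ) - r ^ 2 / 2 * ∫ x, ‖gradient g x‖ ^ 2 ∂μ with ha
  have hkey : ENNReal.ofReal a * μ (Metric.ball 0 r) ≤ ENNReal.ofReal ((∫ x, |g x| ∂μ) ^ 2) := by
    rw [ENNReal.ofReal_pow (by positivity),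
      ofReal_integral_eq_lintegral_ofReal h1.abs (ae_of_all _ fun t => abs_nonneg _),
      ← lintegral_lintegral_translate_mul hg.continuous, ← setLIntegral_const]
    refine le_trans (setLIntegral_mono' Metric.isOpen_ball.measurableSet fun h hh => ?_)
      (setLIntegral_le_lintegral _ _)
    refine le_trans (ENNReal.ofReal_le_ofReal (?_ : a ≤ ∫ x, |g (x + h)| * |g x| ∂μ)) ?_
    · refine le_trans ?_ (integral_sq_sub_le_integral_translate_mul hg h2 hD h)
      have hr : ‖h‖ ^ 2 ≤ r ^ 2 :=
        pow_le_pow_left₀ (norm_nonneg h) (mem_ball_zero_iff.1 hh).le 2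
      have : 0 ≤ ∫ x, ‖gradient g x‖ ^ 2 ∂μ := by positivity
      rw [ha]
      gcongr
    · rw [integral_eq_lintegral_of_nonneg_ae (ae_of_all _ fun x => by positivity)
        (by have := hg.continuous; fun_prop)]
      exact ENNReal.ofReal_toReal_le
  have hball : μ (Metric.ball 0 r) = ENNReal.ofReal (μ.real (Metric.ball 0 r)) :=
    (ofReal_measureReal (by finiteness)).symm
  rw [hball, ← ENNReal.ofReal_mul' measureReal_nonneg] at hkey
  exact (ENNReal.ofReal_le_ofReal_iff (by positivity)).1 hkey

open Module in
/-- The Nash inequality, with an explicit constant. -/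
theorem nash_inequality (hE : 0 < finrank ℝ E) (hg : Differentiable ℝ g)
    (h1 : Integrable g μ) (h2 : Integrable (fun x => g x ^ 2) μ)
    (hD : Integrable (fun x => ‖gradient g x‖ ^ 2) μ) :
    (∫ x, g x ^ 2 ∂μ) ^ (((finrank ℝ E : ℝ) + 2) / (finrank ℝ E : ℝ)) ≤
      (2 / μ.real (Metric.ball 0 1)) ^ ((2 : ℝ) / (finrank ℝ E : ℝ)) *
        (∫ x, |g x| ∂μ) ^ ((4 : ℝ) / (finrank ℝ E : ℝ)) * ∫ x, ‖gradient g x‖ ^ 2 ∂μ := by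
  set n := finrank ℝ E with hn
  have hn0 : (0 : ℝ) < n := by exact_mod_cast hE
  set c := μ.real (Metric.ball 0 1) with hc
  have hc0 : 0 < c := ENNReal.toReal_pos (Metric.measure_ball_pos μ 0 one_pos).ne' (by finiteness)
  have hball := sub_mul_measure_ball_le hg h1 h2 hD
  set A := ∫ x, g x ^ 2 ∂μ with hA
  set M := ∫ x, |g x| ∂μ with hM
  set D := ∫ x, ‖gradient g x‖ ^ 2 ∂μ with hDdef
  have hA0 : 0 ≤ A := by positivity
  have hM0 : 0 ≤ M := by positivity
  have hD0 : 0 ≤ D := by positivity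
  rcases hA0.eq_or_lt with hA' | hA'
  · rw [← hA', Real.zero_rpow (by positivity)]
    positivity
  have hMpos : 0 < M := by
    refine hM0.lt_of_ne fun hM' => hA'.ne' ?_
    have := (integral_eq_zero_iff_of_nonneg (fun x => abs_nonneg (g x)) h1.abs).1 hM'.symm
    refine integral_eq_zero_of_ae (this.mono fun x hx => ?_)
    have : g x = 0 := by simpa using hx
    simp [this]
  set X := 2 * M ^ 2 / (c * A) with hX
  have hX0 : 0 < X := by positivity
  have hr0 : 0 < X ^ (1 / (n : ℝ)) := by positivity
  have hb := hball (X ^ (1 / (n : ℝ)))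
  have hrn : (X ^ (1 / (n : ℝ))) ^ n = X := by
    rw [one_div, Real.rpow_inv_natCast_pow hX0.le hE.ne']
  have hr2 : (X ^ (1 / (n : ℝ))) ^ 2 = X ^ (2 / (n : ℝ)) := by
    rw [← Real.rpow_natCast, ← Real.rpow_mul hX0.le]
    congr 1
    push_cast
    ring
  have hvol : μ.real (Metric.ball 0 (X ^ (1 / (n : ℝ)))) = X * c := by
    rw [measureReal_def, Measure.addHaar_ball_of_pos μ 0 hr0, ENNReal.toReal_mul,
      ENNReal.toReal_ofReal (by positivity), ← hn, hrn, hc, measureReal_def]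
  rw [hvol, hr2] at hb
  have hXc : X * c = 2 * M ^ 2 / A := by
    rw [hX]
    field_simp
  have hAle : A ≤ X ^ (2 / (n : ℝ)) * D := by
    rw [hXc, ← mul_div_assoc, div_le_iff₀ hA'] at hb
    have hM2 : 0 < M ^ 2 := by positivity
    have : (A - X ^ (2 / (n : ℝ)) / 2 * D) * 2 ≤ A := by
      refine le_of_mul_le_mul_left ?_ hM2
      linarith
    linarith
  have hXA : X ^ (2 / (n : ℝ)) * A ^ (2 / (n : ℝ)) =
      (2 / c) ^ (2 / (n : ℝ)) * M ^ (4 / (n : ℝ)) := by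
    have hM4 : M ^ (4 / (n : ℝ)) = (M ^ 2) ^ (2 / (n : ℝ)) := by
      rw [← Real.rpow_natCast, ← Real.rpow_mul hM0]
      congr 1
      push_cast
      ring
    rw [hM4, ← Real.mul_rpow hX0.le hA0, ← Real.mul_rpow (by positivity) (by positivity)]
    congr 1
    rw [hX]
    field_simp
  calc A ^ (((n : ℝ) + 2) / n) = A * A ^ (2 / (n : ℝ)) := by
        rw [add_div, div_self hn0.ne', Real.rpow_add hA', Real.rpow_one]
    _ ≤ X ^ (2 / (n : ℝ)) * D * A ^ (2 / (n : ℝ)) := by gcongr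
    _ = _ := by rw [← hXA]; ring

end Nash

section Weight

variable {d : ℕ} {f : EuclideanSpace ℝ (Fin d) → ℝ}

theorem hasFDerivAt_one_add_norm_sq_rpow (q : ℝ) (x : EuclideanSpace ℝ (Fin d)) :
    HasFDerivAt (fun y : EuclideanSpace ℝ (Fin d) => (1 + ‖y‖ ^ 2) ^ q)
      ((q * (1 + ‖x‖ ^ 2) ^ (q - 1)) • (2 • innerSL ℝ x)) x :=
  ((hasStrictFDerivAt_norm_sq x).hasFDerivAt.const_add 1).rpow_const
    (Or.inl (by positivity))

theorem gradient_mul_one_add_norm_sq_rpow (hf : Differentiable ℝ f) (p : ℝ)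
    (x : EuclideanSpace ℝ (Fin d)) :
    gradient (fun y => f y * (1 + ‖y‖ ^ 2) ^ p) x =
      (1 + ‖x‖ ^ 2) ^ p • gradient f x + (2 * p * f x * (1 + ‖x‖ ^ 2) ^ (p - 1)) • x := by
  refine HasGradientAt.gradient ?_
  rw [hasGradientAt_iff_hasFDerivAt]
  refine ((hf x).hasFDerivAt.mul (hasFDerivAt_one_add_norm_sq_rpow p x)).congr_fderiv ?_
  ext v
  simp only [← toDual_gradient, map_add, map_smul, add_apply,
    smul_apply, InnerProductSpace.toDual_apply_apply, innerSL_apply_apply,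
    smul_eq_mul, nsmul_eq_mul]
  push_cast
  ring

theorem hasFDerivAt_sq_mul_rpow_mul_coord (hf : Differentiable ℝ f) (q : ℝ) (i : Fin d)
    (x : EuclideanSpace ℝ (Fin d)) :
    HasFDerivAt (fun y => f y ^ 2 * (1 + ‖y‖ ^ 2) ^ q * y i)
      ((f x ^ 2 * (1 + ‖x‖ ^ 2) ^ q) • EuclideanSpace.proj i +
        x i • (f x ^ 2 • ((q * (1 + ‖x‖ ^ 2) ^ (q - 1)) • (2 • innerSL ℝ x)) +
          (1 + ‖x‖ ^ 2) ^ q • ((2 * f x) • fderiv ℝ f x))) x := by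
  have h1 : HasFDerivAt (fun y => f y ^ 2) ((2 * f x) • fderiv ℝ f x) x := by
    simpa using (hf x).hasFDerivAt.pow 2
  exact (h1.mul (hasFDerivAt_one_add_norm_sq_rpow q x)).mul
    (EuclideanSpace.proj (𝕜 := ℝ) i).hasFDerivAt

/-- The partial derivative `∂ᵢ (f² (1+|x|²)^q xᵢ)`; the sum over `i` is the divergence of the
radial field `f² (1+|x|²)^q x`. -/
def radialDeriv (f : EuclideanSpace ℝ (Fin d) → ℝ) (q : ℝ) (i : Fin d)
    (x : EuclideanSpace ℝ (Fin d)) : ℝ :=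
  f x ^ 2 * (1 + ‖x‖ ^ 2) ^ q + 2 * q * f x ^ 2 * (1 + ‖x‖ ^ 2) ^ (q - 1) * x i ^ 2 +
    2 * f x * (1 + ‖x‖ ^ 2) ^ q * (x i * gradient f x i)

theorem one_add_norm_sq_rpow_add_one (q : ℝ) (x : EuclideanSpace ℝ (Fin d)) :
    (1 + ‖x‖ ^ 2) ^ (q + 1) = (1 + ‖x‖ ^ 2) ^ q * (1 + ‖x‖ ^ 2) :=
  Real.rpow_add_one (by positivity) q

theorem abs_radialDeriv_le (q : ℝ) (i : Fin d) (x : EuclideanSpace ℝ (Fin d)) :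
    |radialDeriv f q i x| ≤ (2 + 2 * |q|) * (f x ^ 2 * (1 + ‖x‖ ^ 2) ^ (q + 1)) +
      ‖gradient f x‖ ^ 2 * (1 + ‖x‖ ^ 2) ^ (q + 1) := by
  obtain ⟨a, ha⟩ : ∃ a, a = (1 + ‖x‖ ^ 2) ^ (q - 1) := ⟨_, rfl⟩
  have ha0 : 0 ≤ a := ha ▸ by positivity
  have hq : (1 + ‖x‖ ^ 2) ^ q = a * (1 + ‖x‖ ^ 2) := by
    rw [ha, ← one_add_norm_sq_rpow_add_one, sub_add_cancel]
  have hxi : x i ^ 2 ≤ ‖x‖ ^ 2 := by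
    simpa using pow_le_pow_left₀ (norm_nonneg _) (PiLp.norm_apply_le x i) 2
  have hgi : gradient f x i ^ 2 ≤ ‖gradient f x‖ ^ 2 := by
    simpa using pow_le_pow_left₀ (norm_nonneg _) (PiLp.norm_apply_le (gradient f x) i) 2
  rw [radialDeriv, one_add_norm_sq_rpow_add_one, hq, ← ha]
  set s := 1 + ‖x‖ ^ 2 with hs
  have hs1 : 1 ≤ s := by rw [hs]; linarith [sq_nonneg ‖x‖]
  have hxs : x i ^ 2 ≤ s := by linarith
  have h1 : |f x ^ 2 * (a * s)| ≤ f x ^ 2 * (a * s * s) := by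
    rw [abs_of_nonneg (by positivity)]
    gcongr
    exact le_mul_of_one_le_right (by positivity) hs1
  have h2 : |2 * q * f x ^ 2 * a * x i ^ 2| ≤ 2 * |q| * (f x ^ 2 * (a * s * s)) := by
    have : |2 * q * f x ^ 2 * a * x i ^ 2| = 2 * |q| * (f x ^ 2 * (a * x i ^ 2)) := by
      simp only [abs_mul, abs_of_nonneg ha0, abs_sq, abs_two]
      ring
    rw [this]
    have : x i ^ 2 ≤ s * s := hxs.trans (le_mul_of_one_le_right (by positivity) hs1)
    rw [mul_assoc a s s]
    gcongr
  have h3 : |2 * f x * (a * s) * (x i * gradient f x i)| ≤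
      f x ^ 2 * (a * s * s) + ‖gradient f x‖ ^ 2 * (a * s * s) := by
    have hyoung : |2 * f x * (x i * gradient f x i)| ≤ f x ^ 2 * s + ‖gradient f x‖ ^ 2 * s := by
      have hb : (f x * x i) ^ 2 ≤ f x ^ 2 * s := by rw [mul_pow]; gcongr
      have hc : gradient f x i ^ 2 ≤ ‖gradient f x‖ ^ 2 * s :=
        hgi.trans (le_mul_of_one_le_right (by positivity) hs1)
      rw [abs_le]
      constructor
      · nlinarith [sq_nonneg (f x * x i + gradient f x i)]
      · nlinarith [sq_nonneg (f x * x i - gradient f x i)]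
    have : |2 * f x * (a * s) * (x i * gradient f x i)| =
        a * s * |2 * f x * (x i * gradient f x i)| := by
      rw [← abs_of_nonneg (by positivity : 0 ≤ a * s), ← abs_mul,
        abs_of_nonneg (by positivity : 0 ≤ a * s)]
      congr 1
      ring
    rw [this]
    calc _ ≤ a * s * (f x ^ 2 * s + ‖gradient f x‖ ^ 2 * s) := by gcongr
      _ = _ := by ring
  refine (abs_add_three _ _ _).trans ?_
  linarith

theorem integrable_radialDeriv (hf : Differentiable ℝ f) {q : ℝ}
    (h2 : Integrable fun x => f x ^ 2 * (1 + ‖x‖ ^ 2) ^ (q + 1))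
    (hD : Integrable fun x => ‖gradient f x‖ ^ 2 * (1 + ‖x‖ ^ 2) ^ (q + 1)) (i : Fin d) :
    Integrable (radialDeriv f q i) := by
  refine ((h2.const_mul (2 + 2 * |q|)).add hD).mono' ?_
    (ae_of_all _ fun x => abs_radialDeriv_le q i x)
  have hg : Measurable fun x => gradient f x i :=
    (EuclideanSpace.proj (𝕜 := ℝ) i).continuous.measurable.comp (measurable_gradient f)
  have hfm := hf.continuous.measurable
  have hx : Measurable fun x : EuclideanSpace ℝ (Fin d) => x i :=
    (EuclideanSpace.proj (𝕜 := ℝ) i).continuous.measurable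
  have hw (q : ℝ) : Measurable fun x : EuclideanSpace ℝ (Fin d) => (1 + ‖x‖ ^ 2) ^ q :=
    ((measurable_norm.pow_const 2).const_add 1).pow_const q
  exact ((((hfm.pow_const 2).mul (hw q)).add
    ((((hfm.pow_const 2).const_mul (2 * q)).mul (hw (q - 1))).mul (hx.pow_const 2))).add
    (((hfm.const_mul 2).mul (hw q)).mul (hx.mul hg))).aestronglyMeasurable

theorem integral_radialDeriv_eq_zero (hf : Differentiable ℝ f) {q : ℝ}
    (h2 : Integrable fun x => f x ^ 2 * (1 + ‖x‖ ^ 2) ^ (q + 1))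
    (hD : Integrable fun x => ‖gradient f x‖ ^ 2 * (1 + ‖x‖ ^ 2) ^ (q + 1)) (i : Fin d) :
    ∫ x, radialDeriv f q i x = 0 := by
  have hder (x : EuclideanSpace ℝ (Fin d)) :
      HasLineDerivAt ℝ (fun y => f y ^ 2 * (1 + ‖y‖ ^ 2) ^ q * y i) (radialDeriv f q i x) x
        (EuclideanSpace.single i 1) := by
    have hline := (hasFDerivAt_sq_mul_rpow_mul_coord hf q i x).hasLineDerivAt
      (EuclideanSpace.single i 1)
    refine hline.congr_deriv ?_
    simp only [← toDual_gradient, add_apply, smul_apply, InnerProductSpace.toDual_apply_apply,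
      innerSL_apply_apply, smul_eq_mul, nsmul_eq_mul, radialDeriv,
      EuclideanSpace.inner_single_right]
    simp
    ring
  have hint : Integrable fun x => f x ^ 2 * (1 + ‖x‖ ^ 2) ^ q * x i := by
    refine h2.mono' ?_ (ae_of_all _ fun x => ?_)
    · have hx : Measurable fun x : EuclideanSpace ℝ (Fin d) => x i :=
        (EuclideanSpace.proj (𝕜 := ℝ) i).continuous.measurable
      have hfm := hf.continuous.measurable
      exact Measurable.aestronglyMeasurable (by fun_prop)
    · rw [one_add_norm_sq_rpow_add_one, norm_mul, ← mul_assoc, Real.norm_of_nonneg (by positivity)]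
      gcongr
      nlinarith [PiLp.norm_apply_le x i, sq_nonneg (‖x‖ - 1)]
  have := integral_bilinear_hasLineDerivAt_right_eq_neg_left_of_integrable
    (μ := (volume : Measure (EuclideanSpace ℝ (Fin d)))) (B := ContinuousLinearMap.mul ℝ ℝ)
    (f := fun _ => 1) (f' := fun _ => 0) (v := EuclideanSpace.single i 1)
    (by simp) (by simpa using integrable_radialDeriv hf h2 hD i)
    (by simpa using hint)
    (fun x _ => (hasFDerivAt_const (1 : ℝ) x).hasLineDerivAt _) (fun x _ => hder x)
  simpa using this

theorem norm_gradient_mul_weight_sq_le (hf : Differentiable ℝ f) {p : ℝ} (hp : 0 ≤ p)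
    (hpd : 2 ≤ 2 * p + d) (x : EuclideanSpace ℝ (Fin d)) :
    ‖gradient (fun y => f y * (1 + ‖y‖ ^ 2) ^ p) x‖ ^ 2 ≤
      ‖gradient f x‖ ^ 2 * (1 + ‖x‖ ^ 2) ^ (2 * p) +
        2 * p * ∑ i, radialDeriv f (2 * p - 1) i x := by
  have hs0 : 0 < 1 + ‖x‖ ^ 2 := by positivity
  obtain ⟨b, hb⟩ : ∃ b, b = (1 + ‖x‖ ^ 2) ^ (p - 1) := ⟨_, rfl⟩
  have hp1 : (1 + ‖x‖ ^ 2) ^ p = b * (1 + ‖x‖ ^ 2) := by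
    rw [hb, ← one_add_norm_sq_rpow_add_one, sub_add_cancel]
  have hp2 : (1 + ‖x‖ ^ 2) ^ (2 * p - 1 - 1) = b ^ 2 := by
    rw [hb, ← Real.rpow_mul_natCast hs0.le]
    congr 1
    push_cast
    ring
  have hp3 : (1 + ‖x‖ ^ 2) ^ (2 * p - 1) = b ^ 2 * (1 + ‖x‖ ^ 2) := by
    rw [← hp2, ← one_add_norm_sq_rpow_add_one, sub_add_cancel]
  have hp4 : (1 + ‖x‖ ^ 2) ^ (2 * p) = b ^ 2 * (1 + ‖x‖ ^ 2) * (1 + ‖x‖ ^ 2) := by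
    rw [← hp3, ← one_add_norm_sq_rpow_add_one, sub_add_cancel]
  have hsum : ∑ i, radialDeriv f (2 * p - 1) i x =
      d * (f x ^ 2 * (b ^ 2 * (1 + ‖x‖ ^ 2))) + 2 * (2 * p - 1) * f x ^ 2 * b ^ 2 * ‖x‖ ^ 2 +
        2 * f x * (b ^ 2 * (1 + ‖x‖ ^ 2)) * ⟪gradient f x, x⟫ := by
    simp only [radialDeriv, hp2, hp3, Finset.sum_add_distrib, ← Finset.mul_sum,
      ← EuclideanSpace.real_norm_sq_eq x, PiLp.inner_apply]
    simp
    ring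
  rw [gradient_mul_one_add_norm_sq_rpow hf, hsum, norm_add_sq_real, norm_smul, norm_smul,
    mul_pow, mul_pow, Real.norm_eq_abs, Real.norm_eq_abs, sq_abs, sq_abs, real_inner_smul_left,
    real_inner_smul_right, hp4, ← hb, hp1]
  have hnn : 0 ≤ 2 * p * f x ^ 2 * b ^ 2 * ((2 * p + d - 2) * ‖x‖ ^ 2 + d) := by
    have : 0 ≤ 2 * p + d - 2 := by linarith
    positivity
  linarith

theorem integrable_norm_gradient_mul_weight_sq (hf : Differentiable ℝ f) {p : ℝ} (hp : 0 ≤ p)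
    (hpd : 2 ≤ 2 * p + d)
    (h2 : Integrable fun x => f x ^ 2 * (1 + ‖x‖ ^ 2) ^ (2 * p))
    (hD : Integrable fun x => ‖gradient f x‖ ^ 2 * (1 + ‖x‖ ^ 2) ^ (2 * p)) :
    Integrable fun x => ‖gradient (fun y => f y * (1 + ‖y‖ ^ 2) ^ p) x‖ ^ 2 := by
  have hq : 2 * p = 2 * p - 1 + 1 := by ring
  have hR (i : Fin d) : Integrable (radialDeriv f (2 * p - 1) i) :=
    integrable_radialDeriv hf (hq ▸ h2) (hq ▸ hD) i
  have hS : Integrable fun x => 2 * p * ∑ i, radialDeriv f (2 * p - 1) i x :=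
    (integrable_finsetSum _ fun i _ => hR i).const_mul (2 * p)
  refine (hD.add hS).mono'
    ((measurable_gradient _).norm.pow_const 2).aestronglyMeasurable (ae_of_all _ fun x => ?_)
  rw [Real.norm_of_nonneg (by positivity)]
  simpa using norm_gradient_mul_weight_sq_le hf hp hpd x

theorem integral_norm_gradient_mul_weight_sq_le (hf : Differentiable ℝ f) {p : ℝ} (hp : 0 ≤ p)
    (hpd : 2 ≤ 2 * p + d)
    (h2 : Integrable fun x => f x ^ 2 * (1 + ‖x‖ ^ 2) ^ (2 * p))
    (hD : Integrable fun x => ‖gradient f x‖ ^ 2 * (1 + ‖x‖ ^ 2) ^ (2 * p)) :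
    ∫ x, ‖gradient (fun y => f y * (1 + ‖y‖ ^ 2) ^ p) x‖ ^ 2 ≤
      ∫ x, ‖gradient f x‖ ^ 2 * (1 + ‖x‖ ^ 2) ^ (2 * p) := by
  have hq : 2 * p = 2 * p - 1 + 1 := by ring
  have hR (i : Fin d) : Integrable (radialDeriv f (2 * p - 1) i) :=
    integrable_radialDeriv hf (hq ▸ h2) (hq ▸ hD) i
  have hS : Integrable fun x => 2 * p * ∑ i, radialDeriv f (2 * p - 1) i x :=
    (integrable_finsetSum _ fun i _ => hR i).const_mul (2 * p)
  refine (integral_mono (integrable_norm_gradient_mul_weight_sq hf hp hpd h2 hD) (hD.add hS)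
    (norm_gradient_mul_weight_sq_le hf hp hpd)).trans_eq ?_
  rw [integral_add' hD hS, integral_const_mul, integral_finsetSum _ fun i _ => hR i,
    Finset.sum_eq_zero fun i _ => integral_radialDeriv_eq_zero hf (hq ▸ h2) (hq ▸ hD) i,
    mul_zero, add_zero]

end Weight

/-- the weighted Nash inequality
`‖f‖_{L²ₖ}^{2+4/d} ≤ C ‖f‖_{L¹_{k/2}}^{4/d} ‖∇f‖²_{L²ₖ}`, with a constant `C` depending
only on `d`, for `k > 0` (when `d ≥ 2`) resp. `k ≥ 2` (when `d = 1`), and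
`f ∈ L¹_{k/2} ∩ H¹ₖ`. -/
theorem stmt11 (d : ℕ) (hd : 1 ≤ d) :
    ∃ C : ℝ, 0 < C ∧ ∀ k : ℝ, ((2 ≤ d → 0 < k) ∧ (d = 1 → 2 ≤ k)) →
      ∀ f : EuclideanSpace ℝ (Fin d) → ℝ,
        Integrable (fun x => |f x| * jap (k / 2) x) →
        Differentiable ℝ f →
        Integrable (fun x => f x ^ 2 * jap k x) →
        Integrable (fun x => ‖gradient f x‖ ^ 2 * jap k x) →
        (∫ x, f x ^ 2 * jap k x) ^ (((d : ℝ) + 2) / (d : ℝ))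
          ≤ C * (∫ x, |f x| * jap (k / 2) x) ^ ((4 : ℝ) / (d : ℝ))
            * ∫ x, ‖gradient f x‖ ^ 2 * jap k x := by
  have hc : 0 < (volume : Measure (EuclideanSpace ℝ (Fin d))).real (Metric.ball 0 1) :=
    ENNReal.toReal_pos (Metric.measure_ball_pos _ 0 one_pos).ne' (by finiteness)
  refine ⟨(2 / (volume : Measure (EuclideanSpace ℝ (Fin d))).real (Metric.ball 0 1)) ^
    ((2 : ℝ) / (d : ℝ)), by positivity, ?_⟩
  intro k hk f h1 hf h2 hD
  obtain ⟨p, rfl⟩ : ∃ p, k = 4 * p := ⟨k / 4, by ring⟩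
  have hp : 0 ≤ p ∧ 2 ≤ 2 * p + d := by
    rcases hd.eq_or_lt with h | h
    · have := hk.2 h.symm
      rw [← h]
      constructor <;> push_cast <;> linarith
    · have := hk.1 h
      have h2d : (2 : ℝ) ≤ d := by exact_mod_cast h
      constructor <;> linarith
  have hj1 : (fun x : EuclideanSpace ℝ (Fin d) => |f x| * jap (4 * p / 2) x) =
      fun x => |f x * (1 + ‖x‖ ^ 2) ^ p| := by
    funext x
    have hw : 0 ≤ (1 + ‖x‖ ^ 2) ^ p := by positivity
    rw [abs_mul, abs_of_nonneg hw, jap]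
    congr 2
    ring
  have hjk (x : EuclideanSpace ℝ (Fin d)) : jap (4 * p) x = (1 + ‖x‖ ^ 2) ^ (2 * p) := by
    rw [jap]
    congr 1
    ring
  have hj2 : (fun x : EuclideanSpace ℝ (Fin d) => f x ^ 2 * (1 + ‖x‖ ^ 2) ^ (2 * p)) =
      fun x => (f x * (1 + ‖x‖ ^ 2) ^ p) ^ 2 := by
    funext x
    rw [mul_pow, ← Real.rpow_mul_natCast (by positivity), mul_comm p]
    norm_num
  simp only [hjk] at h2 hD ⊢
  rw [hj1] at h1 ⊢
  have hg : Differentiable ℝ fun x => f x * (1 + ‖x‖ ^ 2) ^ p := fun x =>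
    (hf x).mul (hasFDerivAt_one_add_norm_sq_rpow p x).differentiableAt
  have hD' := integrable_norm_gradient_mul_weight_sq hf hp.1 hp.2 h2 hD
  have hle := integral_norm_gradient_mul_weight_sq_le hf hp.1 hp.2 h2 hD
  rw [hj2] at h2 ⊢
  have h1' : Integrable fun x => f x * (1 + ‖x‖ ^ 2) ^ p :=
    (integrable_norm_iff hg.continuous.aestronglyMeasurable).1 h1
  have hN := nash_inequality (by rw [finrank_euclideanSpace_fin]; exact hd) hg h1' h2 hD'
  rw [finrank_euclideanSpace_fin] at hN
  refine hN.trans ?_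
  gcongr
end
end

section
/- Let d ≥ 1, k ∈ ℝ, and let f ∈ C_c^∞(ℝ^d; ℝ). Then, setting φ(x) := f(x) ⟨x⟩^{k/2}, one has the identity ∫_{ℝ^d} |∇φ(x)|² dx = ∫_{ℝ^d} |∇f(x)|² ⟨x⟩^k dx − (k/2) ∫_{ℝ^d} f(x)² [ d + (d + k/2 − 2)|x|² ] ⟨x⟩^{k−4} dx. In particular, if d ≥ 2 and k > 0, or if d = 1 and k ≥ 2, then ∫ |∇(f ⟨·⟩^{k/2})|² dx ≤ ∫ |∇f|² ⟨x⟩^k dx. -/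
open MeasureTheory Real Filter Topology RealInnerProductSpace
open scoped BigOperators

noncomputable section

lemma jap_pos {d : ℕ} (k : ℝ) (x : EuclideanSpace ℝ (Fin d)) : 0 < jap k x := by
  unfold jap
  positivity

lemma jap_mul_jap {d : ℕ} (a b : ℝ) (x : EuclideanSpace ℝ (Fin d)) :
    jap a x * jap b x = jap (a + b) x := by
  unfold jap
  rw [← Real.rpow_add (by positivity)]
  ring_nf

lemma jap_two {d : ℕ} (x : EuclideanSpace ℝ (Fin d)) : jap 2 x = 1 + ‖x‖ ^ 2 := by
  simp [jap]

lemma contDiff_jap_s12 {d : ℕ} (k : ℝ) {n : WithTop ℕ∞} :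
    ContDiff ℝ n (jap (d := d) k) := by
  unfold jap
  refine ContDiff.rpow_const_of_ne ?_ fun x => by positivity
  exact contDiff_const.add (contDiff_norm_sq ℝ)

lemma hasFDerivAt_jap {d : ℕ} (k : ℝ) (x : EuclideanSpace ℝ (Fin d)) :
    HasFDerivAt (jap k) ((k * jap (k - 2) x) • innerSL ℝ x) x := by
  have h : HasFDerivAt (fun y : EuclideanSpace ℝ (Fin d) => 1 + ‖y‖ ^ 2)
      (2 • innerSL ℝ x) x :=
    (hasStrictFDerivAt_norm_sq x).hasFDerivAt.const_add 1
  have h' := h.rpow_const (p := k / 2) (Or.inl (by positivity))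
  refine h'.congr_fderiv ?_
  ext v
  simp only [jap, smul_apply, smul_eq_mul, nsmul_eq_mul]
  rw [show (k - 2) / 2 = k / 2 - 1 by ring]
  push_cast
  ring

/-- The gradient of `f ⟨x⟩ᵐ`. -/
lemma gradient_mul_jap {d : ℕ} (m : ℝ) {f : EuclideanSpace ℝ (Fin d) → ℝ}
    {x : EuclideanSpace ℝ (Fin d)} (hf : DifferentiableAt ℝ f x) :
    gradient (fun y => f y * jap m y) x
      = jap m x • gradient f x + (f x * (m * jap (m - 2) x)) • x := by
  refine HasGradientAt.gradient ?_
  rw [hasGradientAt_iff_hasFDerivAt]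
  refine (hf.hasFDerivAt.fun_mul (hasFDerivAt_jap m x)).congr_fderiv ?_
  ext v
  simp [gradient]
  ring

/-- The integral over `ℝᵈ` of a directional derivative of a compactly supported `C¹` function
vanishes. -/
lemma integral_fderiv_apply_eq_zero {E : Type*} [NormedAddCommGroup E] [NormedSpace ℝ E]
    [FiniteDimensional ℝ E] [MeasurableSpace E] [BorelSpace E] (μ : Measure E)
    [μ.IsAddHaarMeasure] {g : E → ℝ} (hg : ContDiff ℝ 1 g) (hgc : HasCompactSupport g) (v : E) :
    ∫ x, fderiv ℝ g x v ∂μ = 0 := by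
  have hint : Integrable (fun x => fderiv ℝ g x v) μ :=
    ((hg.continuous_fderiv one_ne_zero).clm_apply continuous_const).integrable_of_hasCompactSupport
      (hgc.fderiv_apply ℝ v)
  have h := integral_mul_fderiv_eq_neg_fderiv_mul_of_integrable (μ := μ) (𝕜 := ℝ)
    (f := fun _ : E => (1 : ℝ)) (g := g) (v := v) (by simp) (by simpa using hint)
    (by simpa using hg.continuous.integrable_of_hasCompactSupport hgc)
    (fun x _ => differentiableAt_const _) (fun x _ => hg.differentiable one_ne_zero x)
  simpa using h

/-- The divergence theorem for the field `g(x) x`, with `g` compactly supported of class `C¹`. -/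
lemma integral_fderiv_self_add_mul_eq_zero {d : ℕ} {g : EuclideanSpace ℝ (Fin d) → ℝ}
    (hg : ContDiff ℝ 1 g) (hgc : HasCompactSupport g) :
    ∫ x, (fderiv ℝ g x x + d * g x) = 0 := by
  have hcoord (i : Fin d) : ContDiff ℝ 1 (fun y : EuclideanSpace ℝ (Fin d) => y i) := by
    fun_prop
  have hG (i : Fin d) : ContDiff ℝ 1 (fun y : EuclideanSpace ℝ (Fin d) => g y * y i) :=
    hg.mul (hcoord i)
  have hGc (i : Fin d) : HasCompactSupport (fun y : EuclideanSpace ℝ (Fin d) => g y * y i) :=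
    hgc.mul_right
  have hderiv (i : Fin d) (x : EuclideanSpace ℝ (Fin d)) :
      fderiv ℝ (fun y : EuclideanSpace ℝ (Fin d) => g y * y i) x (EuclideanSpace.single i 1)
        = x i * fderiv ℝ g x (EuclideanSpace.single i 1) + g x := by
    have hi : HasFDerivAt (fun y : EuclideanSpace ℝ (Fin d) => y i)
        (EuclideanSpace.proj i : EuclideanSpace ℝ (Fin d) →L[ℝ] ℝ) x :=
      (EuclideanSpace.proj i : EuclideanSpace ℝ (Fin d) →L[ℝ] ℝ).hasFDerivAt
    rw [((hg.differentiable one_ne_zero x).hasFDerivAt.fun_mul hi).fderiv]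
    simp
    ring
  have hsum (x : EuclideanSpace ℝ (Fin d)) : fderiv ℝ g x x + d * g x
      = ∑ i, fderiv ℝ (fun y : EuclideanSpace ℝ (Fin d) => g y * y i) x
          (EuclideanSpace.single i 1) := by
    have hx : x = ∑ i, x i • EuclideanSpace.single i (1 : ℝ) := by
      simpa using ((EuclideanSpace.basisFun (Fin d) ℝ).sum_repr x).symm
    simp only [hderiv, Finset.sum_add_distrib]
    congr 1
    · conv_lhs => rw [congrArg (fderiv ℝ g x) hx]
      simp
    · simp
  simp only [hsum]
  rw [integral_finsetSum _ fun i _ => ?_]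
  · exact Finset.sum_eq_zero fun i _ => integral_fderiv_apply_eq_zero _ (hG i) (hGc i) _
  · exact (((hG i).continuous_fderiv one_ne_zero).clm_apply
      continuous_const).integrable_of_hasCompactSupport ((hGc i).fderiv_apply ℝ _)

/-- The integrands of the weighted gradient identity differ by the divergence of
`(k/2) f² ⟨x⟩ᵏ⁻² x`. -/
lemma norm_sq_gradient_mul_jap {d : ℕ} (k : ℝ) {f : EuclideanSpace ℝ (Fin d) → ℝ}
    {x : EuclideanSpace ℝ (Fin d)} (hf : DifferentiableAt ℝ f x) :
    ‖gradient (fun y => f y * jap (k / 2) y) x‖ ^ 2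
      = ‖gradient f x‖ ^ 2 * jap k x
        - (k / 2) * (f x ^ 2 * ((d : ℝ) + ((d : ℝ) + k / 2 - 2) * ‖x‖ ^ 2) * jap (k - 4) x)
        + (k / 2) * (fderiv ℝ (fun y => f y ^ 2 * jap (k - 2) y) x x
          + d * (f x ^ 2 * jap (k - 2) x)) := by
  have hg : fderiv ℝ (fun y => f y ^ 2 * jap (k - 2) y) x x
      = 2 * f x * fderiv ℝ f x x * jap (k - 2) x
        + f x ^ 2 * ((k - 2) * jap (k - 4) x * ‖x‖ ^ 2) := by
    have hsq : HasFDerivAt (fun y => f y ^ 2) ((2 * f x) • fderiv ℝ f x) x := by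
      simpa using hf.hasFDerivAt.pow 2
    rw [(hsq.fun_mul (hasFDerivAt_jap (k - 2) x)).fderiv]
    simp [show k - 2 - 2 = k - 4 by ring]
    ring
  have hinner : ⟪gradient f x, x⟫ = fderiv ℝ f x x := by
    simp [gradient]
  have h₀ : jap k x = jap (k / 2) x ^ 2 := by
    rw [sq, jap_mul_jap]; ring_nf
  have h₁ : jap (k - 2) x = jap (k / 2) x * jap (k / 2 - 2) x := by
    rw [jap_mul_jap]; ring_nf
  have h₂ : jap (k - 4) x = jap (k / 2 - 2) x ^ 2 := by
    rw [sq, jap_mul_jap]; ring_nf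
  have h₃ : jap (k / 2) x = jap (k / 2 - 2) x * (1 + ‖x‖ ^ 2) := by
    rw [← jap_two, jap_mul_jap]; ring_nf
  rw [gradient_mul_jap _ hf, norm_add_sq_real, norm_smul, norm_smul, inner_smul_left,
    inner_smul_right, hinner, hg, mul_pow, mul_pow, Real.norm_eq_abs, Real.norm_eq_abs,
    sq_abs, sq_abs, h₀, h₁, h₂, h₃]
  simp only [conj_trivial]
  ring

/-- for `f ∈ C_c^∞` and `φ = f⟨x⟩^{k/2}` one has
`∫|∇φ|² = ∫|∇f|²⟨x⟩ᵏ − (k/2)∫ f² [d + (d + k/2 − 2)|x|²] ⟨x⟩^{k−4}`; in particular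
`∫|∇φ|² ≤ ∫|∇f|²⟨x⟩ᵏ` when `d ≥ 2, k > 0` or `d = 1, k ≥ 2`. -/
theorem stmt12 (d : ℕ) (hd : 1 ≤ d) (k : ℝ)
    (f : EuclideanSpace ℝ (Fin d) → ℝ)
    (hf : ContDiff ℝ (⊤ : ℕ∞) f) (hfc : HasCompactSupport f) :
    ((∫ x, ‖gradient (fun y => f y * jap (k / 2) y) x‖ ^ 2)
        = (∫ x, ‖gradient f x‖ ^ 2 * jap k x)
          - (k / 2) * ∫ x, f x ^ 2 *
              ((d : ℝ) + ((d : ℝ) + k / 2 - 2) * ‖x‖ ^ 2) * jap (k - 4) x) ∧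
    (((2 ≤ d ∧ 0 < k) ∨ (d = 1 ∧ 2 ≤ k)) →
      (∫ x, ‖gradient (fun y => f y * jap (k / 2) y) x‖ ^ 2)
        ≤ ∫ x, ‖gradient f x‖ ^ 2 * jap k x) := by
  have hf₁ : ContDiff ℝ 1 f := hf.of_le (by exact_mod_cast le_top)
  have hf2c : HasCompactSupport fun x => f x ^ 2 :=
    hfc.comp_left (g := fun t : ℝ => t ^ 2) (by simp)
  have hg : ContDiff ℝ 1 (fun y => f y ^ 2 * jap (k - 2) y) :=
    (hf₁.pow 2).mul (contDiff_jap_s12 _)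
  have hgc : HasCompactSupport (fun y => f y ^ 2 * jap (k - 2) y) := hf2c.mul_right
  have hgrad : Continuous (gradient f) :=
    (InnerProductSpace.toDual ℝ _).symm.continuous.comp (hf₁.continuous_fderiv one_ne_zero)
  have hgradc : HasCompactSupport fun x => ‖gradient f x‖ ^ 2 :=
    (hfc.fderiv ℝ).comp_left
      (g := fun L => ‖(InnerProductSpace.toDual ℝ (EuclideanSpace ℝ (Fin d))).symm L‖ ^ 2)
      (by simp)
  have hint₁ : Integrable fun x => ‖gradient f x‖ ^ 2 * jap k x :=
    ((hgrad.norm.pow 2).mul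
      (contDiff_jap_s12 (n := 0) k).continuous).integrable_of_hasCompactSupport hgradc.mul_right
  have hint₂ : Integrable fun x =>
      f x ^ 2 * ((d : ℝ) + ((d : ℝ) + k / 2 - 2) * ‖x‖ ^ 2) * jap (k - 4) x :=
    (((hf₁.continuous.pow 2).mul (by fun_prop)).mul
      (contDiff_jap_s12 (n := 0) (k - 4)).continuous).integrable_of_hasCompactSupport
        hf2c.mul_right.mul_right
  have hint₃ : Integrable fun x => fderiv ℝ (fun y => f y ^ 2 * jap (k - 2) y) x x
      + d * (f x ^ 2 * jap (k - 2) x) := by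
    refine Continuous.integrable_of_hasCompactSupport ?_ (HasCompactSupport.add ?_ hgc.mul_left)
    · exact ((hg.continuous_fderiv one_ne_zero).clm_apply continuous_id).add
        (continuous_const.mul hg.continuous)
    · refine (hgc.fderiv ℝ).mono fun x hx => ?_
      contrapose! hx
      simp_all
  have hid : (∫ x, ‖gradient (fun y => f y * jap (k / 2) y) x‖ ^ 2)
      = (∫ x, ‖gradient f x‖ ^ 2 * jap k x)
        - (k / 2) * ∫ x, f x ^ 2 *
            ((d : ℝ) + ((d : ℝ) + k / 2 - 2) * ‖x‖ ^ 2) * jap (k - 4) x := by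
    simp_rw [fun x => norm_sq_gradient_mul_jap k (hf₁.differentiable one_ne_zero x)]
    rw [integral_add (by exact hint₁.sub (hint₂.const_mul _)) (hint₃.const_mul _),
      integral_sub hint₁ (hint₂.const_mul _), integral_const_mul, integral_const_mul,
      integral_fderiv_self_add_mul_eq_zero hg hgc, mul_zero, add_zero]
  refine ⟨hid, fun hdk => ?_⟩
  obtain ⟨hk, hc⟩ : 0 ≤ k ∧ 0 ≤ (d : ℝ) + k / 2 - 2 := by
    rcases hdk with ⟨h2, hk⟩ | ⟨rfl, hk⟩
    · have : (2 : ℝ) ≤ d := by exact_mod_cast h2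
      constructor <;> linarith
    · constructor <;> norm_num <;> linarith
  rw [hid, sub_le_self_iff]
  refine mul_nonneg (by positivity) (integral_nonneg fun x => ?_)
  exact mul_nonneg (mul_nonneg (sq_nonneg _) (by positivity)) (jap_pos _ _).le
end
end

section
/- Let d ≥ 1, k > 0, and let E : ℝ^d → ℝ^d satisfy (H0). Let f ∈ H¹_k be such that div(∇f + E f) ∈ L²_k (i.e. f ∈ D(L)), and let f⁺ := max(f, 0). Then L f⁺ ≥ 1_{{f > 0}} · Lf in the sense of distributions: for every φ ∈ C_c^∞(ℝ^d) with φ ≥ 0, ∫_{ℝ^d} f⁺(x) (Δφ(x) − E(x)·∇φ(x)) dx ≥ ∫_{{f > 0}} (Δf(x) + E(x)·∇f(x) + f(x) div E(x)) φ(x) dx. -/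
open MeasureTheory Real Filter Topology RealInnerProductSpace
open scoped BigOperators

noncomputable section

section

variable {d : ℕ}

lemma dvg_eq_zero_of_notMem_tsupport {V : EuclideanSpace ℝ (Fin d) → EuclideanSpace ℝ (Fin d)}
    {x : EuclideanSpace ℝ (Fin d)} (hx : x ∉ tsupport V) : dvg V x = 0 := by
  have : fderiv ℝ V x = 0 := by
    by_contra h
    exact hx (support_fderiv_subset ℝ h)
  simp [dvg, this]

lemma measurable_dvg (V : EuclideanSpace ℝ (Fin d) → EuclideanSpace ℝ (Fin d)) :
    Measurable (dvg V) := by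
  unfold dvg
  refine Finset.measurable_sum _ fun i _ => ?_
  exact (measurable_fderiv_apply_const ℝ V _).inner measurable_const

lemma dvg_add {V W : EuclideanSpace ℝ (Fin d) → EuclideanSpace ℝ (Fin d)}
    {x : EuclideanSpace ℝ (Fin d)} (hV : DifferentiableAt ℝ V x) (hW : DifferentiableAt ℝ W x) :
    dvg (fun y => V y + W y) x = dvg V x + dvg W x := by
  simp only [dvg, fderiv_fun_add hV hW, add_apply, inner_add_left,
    Finset.sum_add_distrib]

lemma dvg_sub {V W : EuclideanSpace ℝ (Fin d) → EuclideanSpace ℝ (Fin d)}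
    {x : EuclideanSpace ℝ (Fin d)} (hV : DifferentiableAt ℝ V x) (hW : DifferentiableAt ℝ W x) :
    dvg (fun y => V y - W y) x = dvg V x - dvg W x := by
  simp only [dvg, fderiv_fun_sub hV hW, sub_apply, inner_sub_left,
    Finset.sum_sub_distrib]

/-- The Leibniz rule `div (g W) = g div W + ∇g · W`. -/
lemma dvg_smul {g : EuclideanSpace ℝ (Fin d) → ℝ}
    {W : EuclideanSpace ℝ (Fin d) → EuclideanSpace ℝ (Fin d)}
    {x : EuclideanSpace ℝ (Fin d)} (hg : DifferentiableAt ℝ g x) (hW : DifferentiableAt ℝ W x) :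
    dvg (fun y => g y • W y) x = g x * dvg W x + ⟪gradient g x, W x⟫ := by
  have h : ⟪gradient g x, W x⟫
      = ∑ i, fderiv ℝ g x (EuclideanSpace.single i 1) * ⟪W x, EuclideanSpace.single i 1⟫ := by
    rw [← (EuclideanSpace.basisFun (Fin d) ℝ).sum_inner_mul_inner]
    refine Finset.sum_congr rfl fun i _ => ?_
    rw [inner_gradient_left, EuclideanSpace.basisFun_apply, real_inner_comm (W x)]
  simp only [dvg, fderiv_fun_smul hg hW, add_apply,
    smul_apply, ContinuousLinearMap.smulRight_apply, inner_add_left,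
    real_inner_smul_left, Finset.sum_add_distrib, h, Finset.mul_sum]

/-- The divergence theorem for compactly supported differentiable fields: only the divergence,
and not the individual derivatives, is required to be integrable. -/
lemma integral_dvg_eq_zero {n : ℕ}
    {V : EuclideanSpace ℝ (Fin (n + 1)) → EuclideanSpace ℝ (Fin (n + 1))}
    (hV : Differentiable ℝ V) (hc : HasCompactSupport V) (hi : Integrable (dvg V)) :
    ∫ x, dvg V x = 0 := by
  obtain ⟨R, hR, hsub⟩ := hc.isCompact.isBounded.subset_ball_lt 0 0
  have hout : ∀ (y : Fin (n + 1) → ℝ) (i : Fin (n + 1)), R ≤ |y i| →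
      WithLp.toLp 2 y ∉ tsupport V := by
    intro y i hy hmem
    have h1 := hsub hmem
    rw [mem_ball_zero_iff] at h1
    have h2 := PiLp.norm_apply_le (WithLp.toLp 2 y) i
    simp only [Real.norm_eq_abs] at h2
    linarith
  have hmp := PiLp.volume_preserving_toLp (Fin (n + 1))
  have hemb := (MeasurableEquiv.toLp 2 (Fin (n + 1) → ℝ)).measurableEmbedding
  let eL := (EuclideanSpace.equiv (Fin (n + 1)) ℝ)
  let D : (Fin (n + 1) → ℝ) → (Fin (n + 1) → ℝ) →L[ℝ] (Fin (n + 1) → ℝ) := fun y =>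
    eL.toContinuousLinearMap.comp
      ((fderiv ℝ V (WithLp.toLp 2 y)).comp eL.symm.toContinuousLinearMap)
  have hdiv : ∀ y, ∑ i, D y (Pi.single i 1) i = dvg V (WithLp.toLp 2 y) := by
    intro y
    refine Finset.sum_congr rfl fun i _ => ?_
    rw [EuclideanSpace.inner_single_right]
    simp [D, eL]
  rw [← hmp.integral_comp hemb,
    ← setIntegral_eq_integral_of_forall_compl_eq_zero (s := Set.Icc (fun _ => -R) (fun _ => R))]
  · have key := integral_divergence_of_hasFDerivAt_off_countable
      (fun _ : Fin (n + 1) => -R) (fun _ => R) (fun _ => by linarith)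
      (fun y => eL (V (WithLp.toLp 2 y)))
      D ∅ Set.countable_empty
      (Continuous.continuousOn
        (eL.continuous.comp (hV.continuous.comp eL.symm.continuous)))
      (fun y _ => eL.hasFDerivAt.comp y
        ((hV _).hasFDerivAt.comp y eL.symm.hasFDerivAt))
      (by
        simp only [hdiv]
        exact ((hmp.integrable_comp_emb hemb).2 hi).integrableOn)
    simp only [hdiv] at key
    rw [key]
    refine Finset.sum_eq_zero fun i _ => ?_
    have hz : ∀ (c : ℝ) (hc : R ≤ |c|) (y : Fin n → ℝ),
        eL (V (WithLp.toLp 2 (i.insertNth c y : Fin (n + 1) → ℝ))) i = 0 := by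
      intro c hc y
      rw [image_eq_zero_of_notMem_tsupport (hout _ i (by simpa using hc))]
      simp
    simp [hz R (le_abs_self R), hz (-R) (by simpa using le_abs_self R)]
  · intro y hy
    apply dvg_eq_zero_of_notMem_tsupport
    by_contra hmem
    refine hy ⟨fun i => ?_, fun i => ?_⟩ <;> by_contra hlt <;>
      refine hout y i ?_ hmem <;> push Not at hlt
    · linarith [neg_le_abs (y i)]
    · linarith [le_abs_self (y i)]

/-- A `C¹` nondecreasing approximation of the Heaviside function as `ε → 0⁺`. -/
def stepReg (ε s : ℝ) : ℝ := max s 0 ^ 2 / (ε + max s 0 ^ 2)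

/-- The derivative of `stepReg`. -/
def stepRegDeriv (ε s : ℝ) : ℝ := 2 * ε * max s 0 / (ε + max s 0 ^ 2) ^ 2

lemma hasDerivAt_max_zero_sq (s : ℝ) : HasDerivAt (fun s : ℝ => max s 0 ^ 2) (2 * max s 0) s := by
  rcases lt_trichotomy s 0 with h | rfl | h
  · rw [max_eq_right h.le, mul_zero]
    refine (hasDerivAt_const s (0 : ℝ)).congr_of_eventuallyEq ?_
    filter_upwards [Iio_mem_nhds h] with t ht
    simp [max_eq_right (Set.mem_Iio.1 ht).le]
  · rw [hasDerivAt_iff_isLittleO]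
    simp only [max_self, sub_zero, mul_zero, smul_zero, ne_eq, OfNat.ofNat_ne_zero,
      not_false_eq_true, zero_pow]
    have h2 : (fun t : ℝ => t ^ 2) =o[𝓝 0] fun t => t := by
      simpa using Asymptotics.isLittleO_pow_pow (𝕜 := ℝ) (m := 1) (n := 2) (by norm_num)
    refine (Asymptotics.IsBigO.of_bound 1 (Eventually.of_forall fun t => ?_)).trans_isLittleO h2
    rw [Real.norm_of_nonneg (by positivity), Real.norm_of_nonneg (by positivity), one_mul]
    rcases le_total t 0 with h | h
    · simp [max_eq_right h, sq_nonneg]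
    · simp [max_eq_left h]
  · rw [max_eq_left h.le]
    refine HasDerivAt.congr_of_eventuallyEq (f := fun t : ℝ => t ^ 2)
      (by simpa using hasDerivAt_pow 2 s) ?_
    filter_upwards [Ioi_mem_nhds h] with t ht
    simp [max_eq_left (Set.mem_Ioi.1 ht).le]

lemma hasDerivAt_stepReg {ε : ℝ} (hε : 0 < ε) (s : ℝ) :
    HasDerivAt (stepReg ε) (stepRegDeriv ε s) s := by
  have h := hasDerivAt_max_zero_sq s
  refine (h.div (h.const_add ε) (by positivity)).congr_deriv ?_
  unfold stepRegDeriv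
  ring

lemma continuous_stepReg {ε : ℝ} (hε : 0 < ε) : Continuous (stepReg ε) := by
  unfold stepReg
  fun_prop (disch := intros; positivity)

lemma continuous_stepRegDeriv {ε : ℝ} (hε : 0 < ε) : Continuous (stepRegDeriv ε) := by
  unfold stepRegDeriv
  fun_prop (disch := intros; positivity)

lemma abs_stepReg_le {ε : ℝ} (hε : 0 < ε) (s : ℝ) : |stepReg ε s| ≤ 1 := by
  unfold stepReg
  rw [abs_of_nonneg (by positivity), div_le_one (by positivity)]
  linarith

lemma stepRegDeriv_nonneg {ε : ℝ} (hε : 0 < ε) (s : ℝ) : 0 ≤ stepRegDeriv ε s := by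
  unfold stepRegDeriv
  positivity

lemma stepRegDeriv_mul_self (ε s : ℝ) :
    stepRegDeriv ε s * s = 2 * ε * max s 0 ^ 2 / (ε + max s 0 ^ 2) ^ 2 := by
  have : max s 0 * s = max s 0 ^ 2 := by
    rcases le_total s 0 with h | h
    · simp [h]
    · rw [max_eq_left h, sq]
  rw [stepRegDeriv, div_mul_eq_mul_div, mul_assoc, this]

lemma abs_stepRegDeriv_mul_self_le {ε : ℝ} (hε : 0 < ε) (s : ℝ) :
    |stepRegDeriv ε s * s| ≤ 1 := by
  rw [stepRegDeriv_mul_self, abs_of_nonneg (by positivity), div_le_one (by positivity)]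
  nlinarith [sq_nonneg ε, sq_nonneg (max s 0 ^ 2)]

lemma tendsto_stepReg (s : ℝ) :
    Tendsto (fun ε => stepReg ε s) (𝓝[>] 0) (𝓝 (if 0 < s then 1 else 0)) := by
  refine tendsto_nhdsWithin_of_tendsto_nhds ?_
  split_ifs with h
  · have hc : ContinuousAt (fun ε => stepReg ε s) 0 := by
      unfold stepReg
      rw [max_eq_left h.le]
      fun_prop (disch := positivity)
    have h0 : stepReg 0 s = 1 := by
      rw [stepReg, max_eq_left h.le, zero_add, div_self (by positivity)]
    simpa [h0] using hc.tendsto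
  · simp [stepReg, max_eq_right (not_lt.1 h)]

lemma tendsto_stepRegDeriv_mul_self (s : ℝ) :
    Tendsto (fun ε => stepRegDeriv ε s * s) (𝓝[>] 0) (𝓝 0) := by
  refine tendsto_nhdsWithin_of_tendsto_nhds ?_
  rcases le_or_gt s 0 with h | h
  · simp [stepRegDeriv, max_eq_right h]
  · simp only [stepRegDeriv_mul_self, max_eq_left h.le]
    have hc : ContinuousAt (fun ε => 2 * ε * s ^ 2 / (ε + s ^ 2) ^ 2) 0 := by
      fun_prop (disch := positivity)
    simpa using hc.tendsto

lemma gradient_eq_sum (φ : EuclideanSpace ℝ (Fin d) → ℝ) :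
    gradient φ = fun x => ∑ i, fderiv ℝ φ x (EuclideanSpace.single i 1) •
      (EuclideanSpace.single i 1 : EuclideanSpace ℝ (Fin d)) := by
  ext1 x
  rw [← (EuclideanSpace.basisFun (Fin d) ℝ).sum_repr' (gradient φ x)]
  refine Finset.sum_congr rfl fun i _ => ?_
  rw [EuclideanSpace.basisFun_apply, real_inner_comm, inner_gradient_left]

lemma contDiff_gradient_s14 {φ : EuclideanSpace ℝ (Fin d) → ℝ} (hφ : ContDiff ℝ (⊤ : ℕ∞) φ) :
    ContDiff ℝ 1 (gradient φ) := by
  rw [gradient_eq_sum]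
  have h : ContDiff ℝ 1 (fderiv ℝ φ) :=
    (contDiff_infty.1 hφ 2).fderiv_right (by norm_num)
  fun_prop

lemma continuous_dvg {V : EuclideanSpace ℝ (Fin d) → EuclideanSpace ℝ (Fin d)}
    (hV : ContDiff ℝ 1 V) : Continuous (dvg V) := by
  unfold dvg
  have h : Continuous (fderiv ℝ V) := hV.continuous_fderiv one_ne_zero
  fun_prop

lemma support_gradient_subset (φ : EuclideanSpace ℝ (Fin d) → ℝ) :
    Function.support (gradient φ) ⊆ tsupport φ := by
  intro x hx
  refine support_fderiv_subset ℝ (f := φ) fun h => hx ?_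
  simp [gradient, h]

lemma HasCompactSupport.gradient {φ : EuclideanSpace ℝ (Fin d) → ℝ} (hφ : HasCompactSupport φ) :
    HasCompactSupport (gradient φ) :=
  hφ.mono' (support_gradient_subset φ)

lemma HasCompactSupport.lap {φ : EuclideanSpace ℝ (Fin d) → ℝ} (hφ : HasCompactSupport φ) :
    HasCompactSupport (lap φ) :=
  hφ.gradient.mono' fun _ hx => not_imp_comm.1 dvg_eq_zero_of_notMem_tsupport hx

lemma one_le_jap {k : ℝ} (hk : 0 < k) (x : EuclideanSpace ℝ (Fin d)) : 1 ≤ jap k x :=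
  Real.one_le_rpow (by nlinarith [sq_nonneg ‖x‖]) (by positivity)

lemma Lop_eq {E : EuclideanSpace ℝ (Fin d) → EuclideanSpace ℝ (Fin d)}
    {f : EuclideanSpace ℝ (Fin d) → ℝ} {x : EuclideanSpace ℝ (Fin d)}
    (hE : DifferentiableAt ℝ E x) (hf : DifferentiableAt ℝ f x)
    (hf2 : DifferentiableAt ℝ (gradient f) x) :
    Lop E f x = lap f x + ⟪E x, gradient f x⟫ + f x * dvg E x := by
  rw [Lop, dvg_add hf2 (hf.fun_smul hE), dvg_smul hf hE, lap, real_inner_comm (E x)]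
  ring

lemma gradient_comp {η : ℝ → ℝ} {η' : ℝ} {f : EuclideanSpace ℝ (Fin d) → ℝ}
    {x : EuclideanSpace ℝ (Fin d)} (hη : HasDerivAt η η' (f x)) (hf : DifferentiableAt ℝ f x) :
    gradient (fun y => η (f y)) x = η' • gradient f x := by
  have h : HasFDerivAt (fun y => η (f y)) (η' • fderiv ℝ f x) x :=
    hη.comp_hasFDerivAt x hf.hasFDerivAt
  rw [gradient, h.fderiv, gradient, map_smulₛₗ]
  simp

/-- The field `φ (∇f + f E) - f ∇φ`, whose divergence is `φ Lf - f L*φ`. -/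
def greenField (E : EuclideanSpace ℝ (Fin d) → EuclideanSpace ℝ (Fin d))
    (f φ : EuclideanSpace ℝ (Fin d) → ℝ) (x : EuclideanSpace ℝ (Fin d)) :
    EuclideanSpace ℝ (Fin d) :=
  φ x • (gradient f x + f x • E x) - f x • gradient φ x

lemma dvg_greenField {E : EuclideanSpace ℝ (Fin d) → EuclideanSpace ℝ (Fin d)}
    {f φ : EuclideanSpace ℝ (Fin d) → ℝ} {x : EuclideanSpace ℝ (Fin d)}
    (hE : DifferentiableAt ℝ E x) (hf : DifferentiableAt ℝ f x)
    (hf2 : DifferentiableAt ℝ (gradient f) x) (hφ : DifferentiableAt ℝ φ x)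
    (hφ2 : DifferentiableAt ℝ (gradient φ) x) :
    dvg (greenField E f φ) x
      = Lop E f x * φ x - f x * (lap φ x - ⟪E x, gradient φ x⟫) := by
  have hV : DifferentiableAt ℝ (fun y => gradient f y + f y • E y) x :=
    hf2.fun_add (hf.fun_smul hE)
  unfold greenField
  rw [dvg_sub (hφ.fun_smul hV) (hf.fun_smul hφ2), dvg_smul hφ hV, dvg_smul hf hφ2, inner_add_right,
    real_inner_smul_right, real_inner_comm (gradient f x), real_inner_comm (E x), Lop, lap]
  ring

lemma differentiable_greenField {E : EuclideanSpace ℝ (Fin d) → EuclideanSpace ℝ (Fin d)}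
    {f φ : EuclideanSpace ℝ (Fin d) → ℝ} (hE : Differentiable ℝ E) (hf : Differentiable ℝ f)
    (hf2 : Differentiable ℝ (gradient f)) (hφ : Differentiable ℝ φ)
    (hφ2 : Differentiable ℝ (gradient φ)) : Differentiable ℝ (greenField E f φ) := by
  unfold greenField
  fun_prop

lemma hasCompactSupport_greenField (E : EuclideanSpace ℝ (Fin d) → EuclideanSpace ℝ (Fin d))
    (f : EuclideanSpace ℝ (Fin d) → ℝ) {φ : EuclideanSpace ℝ (Fin d) → ℝ}
    (hφ : HasCompactSupport φ) : HasCompactSupport (greenField E f φ) := by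
  refine hφ.mono' fun x hx => not_not.1 fun h => hx ?_
  have hg : gradient φ x = 0 := not_not.1 fun hne => h (support_gradient_subset φ hne)
  simp [greenField, image_eq_zero_of_notMem_tsupport h, hg]

/-- Local integrability of `Lf`, tested against `φ`. -/
lemma integrable_Lop_mul {E : EuclideanSpace ℝ (Fin d) → EuclideanSpace ℝ (Fin d)}
    {f φ : EuclideanSpace ℝ (Fin d) → ℝ} {k : ℝ} (hk : 0 < k)
    (hL : Integrable (fun x => Lop E f x ^ 2 * jap k x))
    (hφ : Continuous φ) (hφc : HasCompactSupport φ) :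
    Integrable (fun x => Lop E f x * φ x) := by
  have hφ2 : Integrable (fun x => φ x * φ x) :=
    (hφ.mul hφ).integrable_of_hasCompactSupport hφc.mul_right
  refine (hL.add hφ2).mono' ((measurable_dvg _).mul hφ.measurable).aestronglyMeasurable
    (Eventually.of_forall fun x => ?_)
  have h1 : Lop E f x ^ 2 ≤ Lop E f x ^ 2 * jap k x :=
    le_mul_of_one_le_right (sq_nonneg _) (one_le_jap hk x)
  rw [Real.norm_eq_abs, Pi.add_apply, abs_le]
  constructor <;> nlinarith [sq_nonneg (Lop E f x + φ x), sq_nonneg (Lop E f x - φ x)]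

end

/-- Kato's inequality for the positive part, `Lf⁺ ≥ 1_{{f>0}}·Lf` in the
sense of distributions, for `f ∈ D(L)`: for every test function `φ ≥ 0`,
`∫ f⁺ (Δφ − E·∇φ) ≥ ∫_{{f>0}} (Δf + E·∇f + f div E) φ`. -/
theorem stmt14 (d : ℕ) (hd : 1 ≤ d) (k : ℝ) (hk : 0 < k)
    (E : EuclideanSpace ℝ (Fin d) → EuclideanSpace ℝ (Fin d)) (hE0 : H0 E)
    (f : EuclideanSpace ℝ (Fin d) → ℝ)
    (hfd : Differentiable ℝ f)
    (hfd2 : Differentiable ℝ (gradient f))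
    (hfL2 : Integrable (fun x => f x ^ 2 * jap k x))
    (hgradL2 : Integrable (fun x => ‖gradient f x‖ ^ 2 * jap k x))
    (hLfL2 : Integrable (fun x => Lop E f x ^ 2 * jap k x))
    (φ : EuclideanSpace ℝ (Fin d) → ℝ)
    (hφ : ContDiff ℝ (⊤ : ℕ∞) φ) (hφc : HasCompactSupport φ) (hφpos : ∀ x, 0 ≤ φ x) :
    (∫ x, max (f x) 0 * (lap φ x - ⟪E x, gradient φ x⟫))
      ≥ ∫ x in {x | 0 < f x},
          (lap f x + ⟪E x, gradient f x⟫ + f x * dvg E x) * φ x := by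
  obtain ⟨hEd, -⟩ := hE0
  have hfc := hfd.continuous
  have hEc := hEd.continuous
  have hgc := hfd2.continuous
  have hφ1 := contDiff_gradient_s14 hφ
  have hφg := hφ1.continuous
  have hφd : Differentiable ℝ φ := hφ.differentiable (by simp)
  have hφl : Continuous (lap φ) := continuous_dvg hφ1
  have hLφ : Integrable (fun x => Lop E f x * φ x) :=
    integrable_Lop_mul hk hLfL2 hφ.continuous hφc
  have hadj_cont : Continuous (fun x => lap φ x - ⟪E x, gradient φ x⟫) := by fun_prop
  have hadj_supp : HasCompactSupport (fun x => lap φ x - ⟪E x, gradient φ x⟫) :=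
    hφc.lap.sub (hφc.gradient.mono fun x hx h => hx (by simp [h]))
  set A : EuclideanSpace ℝ (Fin d) → ℝ :=
    fun x => Lop E f x * φ x - f x * (lap φ x - ⟪E x, gradient φ x⟫) with hA
  set G : EuclideanSpace ℝ (Fin d) → ℝ :=
    fun x => φ x * ⟪gradient f x, E x⟫ - ⟪gradient f x, gradient φ x⟫ with hG
  have hAi : Integrable A :=
    hLφ.sub ((hfc.mul hadj_cont).integrable_of_hasCompactSupport hadj_supp.mul_left)
  have hGc : Continuous G := by
    have := hφ.continuous
    fun_prop
  have hGs : HasCompactSupport G :=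
    hφc.mul_right.sub (hφc.gradient.mono fun x hx h => hx (by simp [h]))
  have hGi : Integrable G := hGc.integrable_of_hasCompactSupport hGs
  have hWd : Differentiable ℝ (greenField E f φ) :=
    differentiable_greenField hEd hfd hfd2 hφd (hφ1.differentiable one_ne_zero)
  have hWs : HasCompactSupport (greenField E f φ) :=
    hasCompactSupport_greenField E f hφc
  have hdvgW : ∀ x, dvg (greenField E f φ) x = A x := fun x =>
    dvg_greenField (hEd x) (hfd x) (hfd2 x) (hφd x) (hφ1.differentiable one_ne_zero x)
  have hη_int : ∀ ε > 0, Integrable (fun x => stepReg ε (f x) * A x) := fun ε hε =>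
    hAi.bdd_mul ((continuous_stepReg hε).comp hfc).aestronglyMeasurable
      (Eventually.of_forall fun x => abs_stepReg_le hε (f x))
  have hη'_int : ∀ ε > 0, Integrable (fun x => stepRegDeriv ε (f x) * f x * G x) := fun ε hε =>
    hGi.bdd_mul (((continuous_stepRegDeriv hε).comp hfc).mul hfc).aestronglyMeasurable
      (Eventually.of_forall fun x => abs_stepRegDeriv_mul_self_le hε (f x))
  have hreg : ∀ ε > 0,
      ∫ x, (stepReg ε (f x) * A x + stepRegDeriv ε (f x) * f x * G x) ≤ 0 := by
    intro ε hε
    have hη' := (continuous_stepRegDeriv hε).comp hfc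
    have hηd : Differentiable ℝ (fun x => stepReg ε (f x)) := fun x =>
      ((hasDerivAt_stepReg hε (f x)).differentiableAt).comp x (hfd x)
    have hP : Integrable (fun x => φ x * (stepRegDeriv ε (f x) * ‖gradient f x‖ ^ 2)) :=
      (hφ.continuous.mul (hη'.mul (hgc.norm.pow 2))).integrable_of_hasCompactSupport
        hφc.mul_right
    have hdvg : dvg (fun x => stepReg ε (f x) • greenField E f φ x) = fun x =>
        (stepReg ε (f x) * A x + stepRegDeriv ε (f x) * f x * G x)
          + φ x * (stepRegDeriv ε (f x) * ‖gradient f x‖ ^ 2) := by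
      ext1 x
      rw [dvg_smul (hηd x) (hWd x), hdvgW, gradient_comp (hasDerivAt_stepReg hε (f x)) (hfd x),
        hG, greenField, real_inner_smul_left, inner_sub_right, real_inner_smul_right,
        real_inner_smul_right, inner_add_right, real_inner_smul_right,
        real_inner_self_eq_norm_sq]
      ring
    have hsum : Integrable
        (fun x => stepReg ε (f x) * A x + stepRegDeriv ε (f x) * f x * G x) :=
      (hη_int ε hε).add (hη'_int ε hε)
    have hzero : ∫ x, dvg (fun x => stepReg ε (f x) • greenField E f φ x) x = 0 := by
      obtain ⟨n, rfl⟩ := Nat.exists_eq_add_of_le' hd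
      refine integral_dvg_eq_zero (hηd.fun_smul hWd)
        (hWs.mono fun x hx h => hx (by simp [h])) ?_
      rw [hdvg]
      exact hsum.add hP
    rw [hdvg, integral_add hsum hP] at hzero
    have hP0 : 0 ≤ ∫ x, φ x * (stepRegDeriv ε (f x) * ‖gradient f x‖ ^ 2) :=
      integral_nonneg fun x =>
        mul_nonneg (hφpos x) (mul_nonneg (stepRegDeriv_nonneg hε _) (sq_nonneg _))
    linarith
  have hlim : Tendsto
      (fun ε => ∫ x, (stepReg ε (f x) * A x + stepRegDeriv ε (f x) * f x * G x)) (𝓝[>] 0)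
      (𝓝 (∫ x, ((if 0 < f x then 1 else 0) * A x + 0 * G x))) := by
    refine tendsto_integral_filter_of_dominated_convergence (fun x => ‖A x‖ + ‖G x‖) ?_ ?_
      (hAi.norm.add hGi.norm) (Eventually.of_forall fun x =>
        ((tendsto_stepReg (f x)).mul_const _).add
          ((tendsto_stepRegDeriv_mul_self (f x)).mul_const _))
    · filter_upwards [self_mem_nhdsWithin] with ε hε
      exact ((hη_int ε hε).add (hη'_int ε hε)).aestronglyMeasurable
    · filter_upwards [self_mem_nhdsWithin] with ε hε
      refine Eventually.of_forall fun x => (norm_add_le _ _).trans ?_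
      rw [norm_mul, norm_mul (stepRegDeriv ε (f x) * f x)]
      exact add_le_add
        (mul_le_of_le_one_left (norm_nonneg _) (abs_stepReg_le hε _))
        (mul_le_of_le_one_left (norm_nonneg _) (abs_stepRegDeriv_mul_self_le hε _))
  have hle := le_of_tendsto hlim (eventually_nhdsWithin_of_forall hreg)
  have hset : MeasurableSet {x | 0 < f x} := measurableSet_lt measurable_const hfc.measurable
  have hsplit : ∀ x, (if 0 < f x then (1 : ℝ) else 0) * A x + 0 * G x
      = Set.indicator {x | 0 < f x} (fun x => Lop E f x * φ x) x
        - max (f x) 0 * (lap φ x - ⟪E x, gradient φ x⟫) := by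
    intro x
    by_cases h : 0 < f x
    · simp [h, hA, max_eq_left h.le]
    · simp [h, max_eq_right (not_lt.1 h)]
  have hpos : Integrable (fun x => max (f x) 0 * (lap φ x - ⟪E x, gradient φ x⟫)) :=
    ((hfc.max continuous_const).mul hadj_cont).integrable_of_hasCompactSupport
      hadj_supp.mul_left
  simp only [hsplit] at hle
  rw [integral_sub (hLφ.indicator hset) hpos, integral_indicator hset] at hle
  simp only [Lop_eq (hEd _) (hfd _) (hfd2 _)] at hle
  linarith
end
end
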